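/- arXiv:1607.06254 — 3 statements merged into one kernel-verified Lean document; each statement's English description precedes it below -/
import Mathlib

section
/- Let a>0, b>0 and α∈(1,2). Then for each t>0 the integrand ξ ↦ e^{−ixξ} exp( −a ∫₀^t v_s(−iξ) ds ) is (absolutely) integrable over ℝ, so f(t,x) := (1/(2π)) ∫_{−∞}^{∞} e^{−ixξ} exp( −a ∫₀^t v_s(−iξ) ds ) dξ is well-defined; moreover (t,x) ↦ f(t,x) is jointly continuous on (0,∞) × ℝ, and for each fixed t>0 the function x ↦ f(t,x) is infinitely differentiable on ℝ. -/
open Real MeasureTheory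

/-- The complex extension of the function `v_s(z)`, defined via principal-branch
complex powers (with the convention `0 ^ β = 0`). -/
noncomputable def vC (b α : ℝ) (s : ℝ) (z : ℂ) : ℂ :=
  ((1 / ((α : ℂ) * (b : ℂ)) + z ^ ((1 : ℂ) - (α : ℂ))) * Complex.exp ((b * (α - 1) * s : ℝ) : ℂ)
      - 1 / ((α : ℂ) * (b : ℂ))) ^ ((1 : ℂ) / (1 - (α : ℂ)))

/-- The candidate density `f(t,x) = (1/2π) ∫ e^{-ixξ} exp(-a ∫₀ᵗ v_s(-iξ) ds) dξ`. -/
noncomputable def fDen (a b α : ℝ) (t x : ℝ) : ℂ :=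
  ((1 / (2 * Real.pi) : ℝ) : ℂ) *
    ∫ ξ : ℝ, Complex.exp (-Complex.I * (x : ℂ) * (ξ : ℂ)) *
      Complex.exp (-(a : ℂ) * ∫ s in (0:ℝ)..t, vC b α s (-Complex.I * (ξ : ℂ)))


lemma aux_cpow (α ξ : ℝ) (hα : 1 < α) (hξ : ξ ≠ 0) :
    ∃ θ : ℝ, |θ| = (α - 1) * (π / 2) ∧
      (-Complex.I * (ξ : ℂ)) ^ ((1 : ℂ) - (α : ℂ)) =
        ((|ξ| ^ (1 - α) : ℝ) : ℂ) * Complex.exp (θ * Complex.I) := by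
  refine ⟨(1 - α) * Complex.arg (-Complex.I * (ξ : ℂ)), ?_, ?_⟩
  · have h : |Complex.arg (-Complex.I * (ξ : ℂ))| = π / 2 := by
      rcases lt_or_gt_of_ne hξ with h | h
      · rw [Complex.arg_eq_pi_div_two_iff.2 (by simp [h]), abs_of_pos (by positivity)]
      · rw [Complex.arg_eq_neg_pi_div_two_iff.2 (by simp [h]), abs_neg, abs_of_pos (by positivity)]
    rw [abs_mul, h, abs_sub_comm, abs_of_pos (by linarith)]
  · have hz : (-Complex.I * (ξ : ℂ)) ≠ 0 := by simp [hξ]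
    have hn : ‖(-Complex.I * (ξ : ℂ))‖ = |ξ| := by simp
    rw [Complex.cpow_def_of_ne_zero hz, Complex.log, hn, Real.rpow_def_of_pos (abs_pos.2 hξ),
      Complex.ofReal_exp, ← Complex.exp_add]
    congr 1
    push_cast
    ring

lemma aux_arg (p q θ : ℝ) (hp : 0 ≤ p) (hq : 0 < q) (hθ : |θ| < π / 2) :
    0 < ((p : ℂ) + (q : ℂ) * Complex.exp (θ * Complex.I)).re ∧
    |Complex.arg ((p : ℂ) + (q : ℂ) * Complex.exp (θ * Complex.I))| ≤ |θ| ∧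
    (0 < p → θ ≠ 0 →
      |Complex.arg ((p : ℂ) + (q : ℂ) * Complex.exp (θ * Complex.I))| < |θ|) := by
  set w : ℂ := (p : ℂ) + (q : ℂ) * Complex.exp (θ * Complex.I) with hw
  have hre : w.re = p + q * Real.cos θ := by
    simp [hw, Complex.exp_ofReal_mul_I_re]
  have him : w.im = q * Real.sin θ := by
    simp [hw, Complex.exp_ofReal_mul_I_im]
  have hc : 0 < Real.cos θ := Real.cos_pos_of_mem_Ioo ⟨(abs_lt.1 hθ).1, (abs_lt.1 hθ).2⟩
  have hpos : 0 < w.re := by rw [hre]; positivity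
  have harg : |Complex.arg w| < π / 2 := Complex.abs_arg_lt_pi_div_two_iff.2 (Or.inl hpos)
  have habs : ∀ x : ℝ, |x| < π / 2 → Real.tan |x| = |Real.tan x| := by
    intro x hx
    have h0 : 0 ≤ Real.tan |x| := Real.tan_nonneg_of_nonneg_of_le_pi_div_two (abs_nonneg x) hx.le
    rcases abs_choice x with h | h
    · rw [h] at h0 ⊢; rw [abs_of_nonneg h0]
    · rw [h] at h0 ⊢; rw [Real.tan_neg] at h0 ⊢; rw [abs_of_nonpos (by linarith)]
  have mem : ∀ x : ℝ, |x| < π / 2 → |x| ∈ Set.Ioo (-(π / 2)) (π / 2) := by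
    intro x hx
    exact ⟨by linarith [abs_nonneg x, Real.pi_pos], hx⟩
  have hpos' : 0 < p + q * Real.cos θ := hre ▸ hpos
  have htw : Real.tan |Complex.arg w| = q * |Real.sin θ| / (p + q * Real.cos θ) := by
    rw [habs _ harg, Complex.tan_arg, hre, him, abs_div, abs_mul, abs_of_pos hq,
      abs_of_pos hpos']
  have htt : Real.tan |θ| = |Real.sin θ| / Real.cos θ := by
    rw [habs _ hθ, Real.tan_eq_sin_div_cos, abs_div, abs_of_pos hc]
  refine ⟨hpos, ?_, ?_⟩
  · rw [← Real.strictMonoOn_tan.le_iff_le (mem _ harg) (mem _ hθ), htw, htt,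
      div_le_div_iff₀ hpos' hc]
    nlinarith [mul_nonneg (abs_nonneg (Real.sin θ)) hp]
  · intro hp' h0
    rw [← Real.strictMonoOn_tan.lt_iff_lt (mem _ harg) (mem _ hθ), htw, htt,
      div_lt_div_iff₀ hpos' hc]
    have hs : 0 < |Real.sin θ| := by
      rw [abs_pos]
      intro h
      rw [Real.sin_eq_zero_iff_of_lt_of_lt] at h
      · exact h0 h
      · linarith [(abs_lt.1 hθ).1, Real.pi_pos]
      · linarith [(abs_lt.1 hθ).2, Real.pi_pos]
    nlinarith [mul_pos hs hp']

lemma aux_re (w : ℂ) (β : ℝ) (hw : w ≠ 0) :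
    (w ^ (β : ℂ)).re = ‖w‖ ^ β * Real.cos (Complex.arg w * β) := by
  rw [Complex.cpow_def_of_ne_zero hw, Complex.exp_re]
  have h1 : (Complex.log w * β).re = Real.log ‖w‖ * β := by simp [Complex.log_re]
  have h2 : (Complex.log w * β).im = Complex.arg w * β := by simp [Complex.log_im]
  rw [h1, h2, Real.rpow_def_of_pos (norm_pos_iff.2 hw)]

lemma aux_re_v (α p q θ : ℝ) (hα : 1 < α) (hα2 : α < 2) (hθ : |θ| = (α - 1) * (π / 2))
    (hp : 0 ≤ p) (hq : 0 < q) :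
    ((p : ℂ) + (q : ℂ) * Complex.exp (θ * Complex.I)) ∈ Complex.slitPlane ∧
    0 ≤ (((p : ℂ) + (q : ℂ) * Complex.exp (θ * Complex.I)) ^ ((1 / (1 - α) : ℝ) : ℂ)).re ∧
    (0 < p →
      0 < (((p : ℂ) + (q : ℂ) * Complex.exp (θ * Complex.I)) ^ ((1 / (1 - α) : ℝ) : ℂ)).re) := by
  have hpi := Real.pi_pos
  have hα0 : 0 < α - 1 := by linarith
  have hθ' : |θ| < π / 2 := by rw [hθ]; nlinarith
  obtain ⟨h1, h2, h3⟩ := aux_arg p q θ hp hq hθ'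
  set w : ℂ := (p : ℂ) + (q : ℂ) * Complex.exp (θ * Complex.I) with hw
  have hw0 : w ≠ 0 := by intro h; rw [h] at h1; simp at h1
  have hθ0 : θ ≠ 0 := by
    rw [← abs_pos, hθ]; positivity
  have habs : |Complex.arg w * (1 / (1 - α))| = |Complex.arg w| / (α - 1) := by
    rw [abs_mul, abs_div, abs_one, abs_sub_comm, abs_of_pos hα0]; ring
  refine ⟨Or.inl h1, ?_, ?_⟩
  · rw [aux_re w _ hw0]
    refine mul_nonneg (by positivity) (Real.cos_nonneg_of_mem_Icc ?_)
    rw [Set.mem_Icc, ← abs_le, habs, div_le_iff₀ hα0]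
    linarith
  · intro hp'
    rw [aux_re w _ hw0]
    refine mul_pos (Real.rpow_pos_of_pos (norm_pos_iff.2 hw0) _) (Real.cos_pos_of_mem_Ioo ?_)
    rw [Set.mem_Ioo, ← abs_lt, habs, div_lt_iff₀ hα0]
    linarith [h3 hp' hθ0]

lemma aux_compact (α θ p1 p2 q2 : ℝ) (hα : 1 < α) (hα2 : α < 2)
    (hθ : |θ| = (α - 1) * (π / 2)) (hp1 : 0 < p1) :
    ∃ m : ℝ, 0 < m ∧ ∀ p ∈ Set.Icc p1 p2, ∀ q ∈ Set.Icc 1 q2,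
      m ≤ (((p : ℂ) + (q : ℂ) * Complex.exp (θ * Complex.I)) ^ ((1 / (1 - α) : ℝ) : ℂ)).re := by
  have hcont : ContinuousOn (fun x : ℝ × ℝ => (((x.1 : ℂ) + (x.2 : ℂ) *
      Complex.exp (θ * Complex.I)) ^ ((1 / (1 - α) : ℝ) : ℂ)).re)
      (Set.Icc p1 p2 ×ˢ Set.Icc 1 q2) := by
    refine Complex.continuous_re.comp_continuousOn ?_
    refine ContinuousOn.cpow_const (by fun_prop) ?_
    rintro ⟨p, q⟩ ⟨hp, hq⟩
    exact (aux_re_v α p q θ hα hα2 hθ (hp1.le.trans hp.1) (one_pos.trans_le hq.1)).1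
  obtain ⟨m, hm, hm2⟩ := (isCompact_Icc.prod isCompact_Icc).exists_forall_le' hcont (a := 0) (by
    rintro ⟨p, q⟩ ⟨hp, hq⟩
    exact (aux_re_v α p q θ hα hα2 hθ (hp1.le.trans hp.1) (one_pos.trans_le hq.1)).2.2
      (hp1.trans_le hp.1))
  exact ⟨m, hm, fun p hp q hq => hm2 (p, q) ⟨hp, hq⟩⟩

lemma vC_eq (b α s ξ θ : ℝ)
    (h : (-Complex.I * (ξ : ℂ)) ^ ((1 : ℂ) - (α : ℂ)) =
        ((|ξ| ^ (1 - α) : ℝ) : ℂ) * Complex.exp (θ * Complex.I)) :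
    vC b α s (-Complex.I * (ξ : ℂ)) =
      (((1 / (α * b) * (Real.exp (b * (α - 1) * s) - 1) : ℝ) : ℂ) +
        ((|ξ| ^ (1 - α) * Real.exp (b * (α - 1) * s) : ℝ) : ℂ) *
          Complex.exp (θ * Complex.I)) ^ ((1 / (1 - α) : ℝ) : ℂ) := by
  unfold vC
  rw [h]
  congr 1
  · push_cast
    ring
  · push_cast; rfl

lemma aux_mul_cpow (r : ℝ) (w β : ℂ) (hr : 0 < r) (hβ : β ≠ 0) :
    ((r : ℂ) * w) ^ β = (r : ℂ) ^ β * w ^ β := by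
  have hr' : (r : ℂ) ≠ 0 := by exact_mod_cast hr.ne'
  by_cases hw : w = 0
  · simp [hw, Complex.zero_cpow hβ]
  · rw [Complex.cpow_def_of_ne_zero hw, Complex.cpow_def_of_ne_zero hr',
      Complex.cpow_def_of_ne_zero (mul_ne_zero hr' hw), Complex.log_ofReal_mul hr hw,
      Complex.ofReal_log hr.le, ← Complex.exp_add]
    congr 1
    ring

lemma vC_eq' (b α s ξ θ : ℝ) (hα : 1 < α) (hξ : ξ ≠ 0)
    (h : (-Complex.I * (ξ : ℂ)) ^ ((1 : ℂ) - (α : ℂ)) =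
        ((|ξ| ^ (1 - α) : ℝ) : ℂ) * Complex.exp (θ * Complex.I)) :
    vC b α s (-Complex.I * (ξ : ℂ)) =
      (((|ξ| ^ (1 - α)) ^ (1 / (1 - α)) : ℝ) : ℂ) *
      (((1 / (α * b) * (Real.exp (b * (α - 1) * s) - 1) / |ξ| ^ (1 - α) : ℝ) : ℂ) +
        ((Real.exp (b * (α - 1) * s) : ℝ) : ℂ) *
          Complex.exp (θ * Complex.I)) ^ ((1 / (1 - α) : ℝ) : ℂ) := by
  have hr : 0 < |ξ| ^ (1 - α) := Real.rpow_pos_of_pos (abs_pos.2 hξ) _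
  rw [vC_eq b α s ξ θ h]
  generalize |ξ| ^ (1 - α) = r at hr
  rw [Complex.ofReal_cpow hr.le, ← aux_mul_cpow r _ _ hr (by
    have : 1 - α ≠ 0 := by linarith
    exact_mod_cast (one_div_ne_zero this))]
  congr 1
  have : (r : ℂ) ≠ 0 := by exact_mod_cast hr.ne'
  push_cast
  field_simp

/-- Continuity in s. -/
lemma vC_cont (b α ξ : ℝ) (hb : 0 < b) (hα : 1 < α) (hα2 : α < 2) (hξ : ξ ≠ 0) :
    ContinuousOn (fun s => vC b α s (-Complex.I * (ξ : ℂ))) (Set.Ici 0) := by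
  obtain ⟨θ, hθ, h⟩ := aux_cpow α ξ hα hξ
  simp_rw [vC_eq b α _ ξ θ h]
  refine ContinuousOn.cpow_const (by fun_prop) ?_
  intro s hs
  have hr : 0 < |ξ| ^ (1 - α) := Real.rpow_pos_of_pos (abs_pos.2 hξ) _
  refine (aux_re_v α _ _ θ hα hα2 hθ ?_ (by positivity)).1
  have : 1 ≤ Real.exp (b * (α - 1) * s) := Real.one_le_exp
    (mul_nonneg (mul_nonneg hb.le (by linarith)) hs)
  exact mul_nonneg (by positivity) (by linarith)

lemma vC_re_nonneg (b α ξ s : ℝ) (hb : 0 < b) (hα : 1 < α) (hα2 : α < 2) (hξ : ξ ≠ 0)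
    (hs : 0 ≤ s) : 0 ≤ (vC b α s (-Complex.I * (ξ : ℂ))).re := by
  obtain ⟨θ, hθ, h⟩ := aux_cpow α ξ hα hξ
  rw [vC_eq b α _ ξ θ h]
  have hr : 0 < |ξ| ^ (1 - α) := Real.rpow_pos_of_pos (abs_pos.2 hξ) _
  refine (aux_re_v α _ _ θ hα hα2 hθ ?_ (by positivity)).2.1
  have : 1 ≤ Real.exp (b * (α - 1) * s) := Real.one_le_exp
    (mul_nonneg (mul_nonneg hb.le (by linarith)) hs)
  exact mul_nonneg (by positivity) (by linarith)

lemma vC_intble (b α ξ u v : ℝ) (hb : 0 < b) (hα : 1 < α) (hα2 : α < 2) (hξ : ξ ≠ 0)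
    (hu : 0 ≤ u) (hv : 0 ≤ v) :
    IntervalIntegrable (fun s => vC b α s (-Complex.I * (ξ : ℂ))) volume u v := by
  refine ((vC_cont b α ξ hb hα hα2 hξ).mono ?_).intervalIntegrable
  intro s hs
  exact (le_inf hu hv).trans hs.1

lemma vC_lower (b α t0 : ℝ) (hb : 0 < b) (hα : 1 < α) (hα2 : α < 2) (ht0 : 0 < t0) :
    ∃ κ D : ℝ, 0 < κ ∧ ∀ ξ : ℝ, ξ ≠ 0 → ∀ t : ℝ, t0 ≤ t →
      κ * |ξ| ^ (2 - α) - D ≤ (∫ s in (0:ℝ)..t, vC b α s (-Complex.I * (ξ : ℂ))).re := by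
  have hδ : 0 < α - 1 := by linarith
  have hα0 : 0 < α := by linarith
  have hpi := Real.pi_pos
  set q2 : ℝ := Real.exp (b * (α - 1) * t0) with hq2
  set p1 : ℝ := 1 / (α * b) * (b * (α - 1)) with hp1
  set p2 : ℝ := 1 / (α * b) * (b * (α - 1) * 2 * q2) with hp2
  have hp1pos : 0 < p1 := by positivity
  obtain ⟨m1, hm1, H1⟩ := aux_compact α ((α - 1) * (π / 2)) p1 p2 q2 hα hα2
    (abs_of_pos (by positivity)) hp1pos
  obtain ⟨m2, hm2, H2⟩ := aux_compact α (-((α - 1) * (π / 2))) p1 p2 q2 hα hα2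
    (by rw [abs_neg]; exact abs_of_pos (by positivity)) hp1pos
  refine ⟨min m1 m2, min m1 m2 * (t0 / 2) ^ ((2 - α) / (1 - α)), lt_min hm1 hm2, ?_⟩
  set m := min m1 m2 with hm
  have hmpos : 0 < m := lt_min hm1 hm2
  intro ξ hξ t ht
  have htpos : 0 < t := ht0.trans_le ht
  have hvi := fun u v hu hv => vC_intble b α ξ u v hb hα hα2 hξ hu hv
  have hre : (∫ s in (0:ℝ)..t, vC b α s (-Complex.I * (ξ : ℂ))).re =
      ∫ s in (0:ℝ)..t, (vC b α s (-Complex.I * (ξ : ℂ))).re := by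
    exact (Complex.reCLM.intervalIntegral_comp_comm (hvi 0 t le_rfl htpos.le)).symm
  have hvire : ∀ u v : ℝ, 0 ≤ u → 0 ≤ v → IntervalIntegrable
      (fun s => (vC b α s (-Complex.I * (ξ : ℂ))).re) volume u v := by
    intro u v hu hv
    refine ContinuousOn.intervalIntegrable (Complex.continuous_re.comp_continuousOn
      ((vC_cont b α ξ hb hα hα2 hξ).mono ?_))
    intro s hs
    exact (le_inf hu hv).trans hs.1
  rw [hre]
  have hξ' : 0 < |ξ| := abs_pos.2 hξ
  have hr : 0 < |ξ| ^ (1 - α) := Real.rpow_pos_of_pos hξ' _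
  obtain ⟨θ, hθ, h⟩ := aux_cpow α ξ hα hξ
  have hne : 1 - α ≠ 0 := by linarith
  have hpow : (|ξ| ^ (1 - α)) ^ ((2 - α) / (1 - α)) = |ξ| ^ (2 - α) := by
    rw [← Real.rpow_mul hξ'.le]
    congr 1
    field_simp
  have hnn : ∀ s, 0 ≤ s → 0 ≤ (vC b α s (-Complex.I * (ξ : ℂ))).re := fun s hs =>
    vC_re_nonneg b α ξ s hb hα hα2 hξ hs
  rcases le_or_gt (|ξ| ^ (1 - α)) (t0 / 2) with hcase | hcase
  · have hpow2 : |ξ| ^ (1 - α) * (|ξ| ^ (1 - α)) ^ (1 / (1 - α)) = |ξ| ^ (2 - α) := by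
      rw [← hpow, ← Real.rpow_one_add' hr.le]
      · congr 1
        field_simp
        ring
      · have : 1 + 1 / (1 - α) = (2 - α) / (1 - α) := by field_simp; ring
        rw [this]
        exact div_ne_zero (by linarith) hne
    have hD : 0 ≤ m * (t0 / 2) ^ ((2 - α) / (1 - α)) := by positivity
    have hlow : ∀ s ∈ Set.Icc (|ξ| ^ (1 - α)) (2 * |ξ| ^ (1 - α)),
        (|ξ| ^ (1 - α)) ^ (1 / (1 - α)) * m ≤ (vC b α s (-Complex.I * (ξ : ℂ))).re := by
      intro s hs
      rw [vC_eq' b α s ξ θ hα hξ h, Complex.re_ofReal_mul]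
      refine mul_le_mul_of_nonneg_left ?_ (by positivity)
      generalize |ξ| ^ (1 - α) = r at *
      have hs0 : 0 < s := hr.trans_le hs.1
      have hx : 0 < b * (α - 1) := by positivity
      have hE1 : b * (α - 1) * s + 1 ≤ Real.exp (b * (α - 1) * s) := Real.add_one_le_exp _
      have hE2 : Real.exp (b * (α - 1) * s) ≤ q2 := by
        rw [hq2]
        apply Real.exp_le_exp.2
        apply mul_le_mul_of_nonneg_left _ hx.le
        linarith [hs.2]
      have hE3 : Real.exp (b * (α - 1) * s) - 1 ≤ b * (α - 1) * s * q2 := by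
        have h1 := Real.add_one_le_exp (-(b * (α - 1) * s))
        have h2 : Real.exp (-(b * (α - 1) * s)) * Real.exp (b * (α - 1) * s) = 1 := by
          rw [← Real.exp_add]; simp
        have h3 := Real.exp_pos (b * (α - 1) * s)
        have h4 := mul_le_mul_of_nonneg_right h1 h3.le
        have h5 := mul_le_mul_of_nonneg_left hE2 (mul_pos hx hs0).le
        nlinarith
      have hsx : b * (α - 1) * r ≤ b * (α - 1) * s := mul_le_mul_of_nonneg_left hs.1 hx.le
      have hsx2 : b * (α - 1) * s * q2 ≤ b * (α - 1) * (2 * r) * q2 :=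
        mul_le_mul_of_nonneg_right (mul_le_mul_of_nonneg_left hs.2 hx.le) (Real.exp_pos _).le
      have hP : 1 / (α * b) * (Real.exp (b * (α - 1) * s) - 1) / r ∈ Set.Icc p1 p2 := by
        have hc : 0 < 1 / (α * b) := by positivity
        constructor
        · rw [le_div_iff₀ hr, hp1, mul_assoc]
          exact mul_le_mul_of_nonneg_left (by linarith) hc.le
        · rw [div_le_iff₀ hr, hp2, mul_assoc (1 / (α * b)) _ r]
          exact mul_le_mul_of_nonneg_left (by linarith) hc.le
      have hQ : Real.exp (b * (α - 1) * s) ∈ Set.Icc 1 q2 := ⟨by nlinarith [mul_pos hx hs0], hE2⟩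
      rcases eq_or_eq_neg_of_abs_eq hθ with h' | h'
      · rw [h']
        exact (min_le_left _ _).trans (H1 _ hP _ hQ)
      · rw [h']
        exact (min_le_right _ _).trans (H2 _ hP _ hQ)
    have h2r : 2 * |ξ| ^ (1 - α) ≤ t := by linarith
    calc m * |ξ| ^ (2 - α) - m * (t0 / 2) ^ ((2 - α) / (1 - α))
        ≤ m * |ξ| ^ (2 - α) := by linarith
      _ = ∫ s in (|ξ| ^ (1 - α))..(2 * |ξ| ^ (1 - α)), (|ξ| ^ (1 - α)) ^ (1 / (1 - α)) * m := by
          rw [intervalIntegral.integral_const, ← hpow2, smul_eq_mul]; ring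
      _ ≤ ∫ s in (|ξ| ^ (1 - α))..(2 * |ξ| ^ (1 - α)), (vC b α s (-Complex.I * (ξ : ℂ))).re := by
          refine intervalIntegral.integral_mono_on (by linarith) (by simp)
            (hvire _ _ hr.le (by linarith)) hlow
      _ ≤ ∫ s in (0:ℝ)..t, (vC b α s (-Complex.I * (ξ : ℂ))).re := by
          refine intervalIntegral.integral_mono_interval hr.le (by linarith) h2r ?_
            (hvire _ _ le_rfl htpos.le)
          filter_upwards [ae_restrict_mem measurableSet_Ioc] with s hs
          exact hnn s hs.1.le
  · have h1 : |ξ| ^ (2 - α) ≤ (t0 / 2) ^ ((2 - α) / (1 - α)) := by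
      rw [← hpow]
      exact Real.rpow_le_rpow_of_nonpos (by linarith) hcase.le
        (div_nonpos_of_nonneg_of_nonpos (by linarith) (by linarith))
    have h2 : 0 ≤ ∫ s in (0:ℝ)..t, (vC b α s (-Complex.I * (ξ : ℂ))).re :=
      intervalIntegral.integral_nonneg htpos.le (fun s hs => hnn s hs.1)
    nlinarith [mul_le_mul_of_nonneg_left h1 hmpos.le]

lemma exp_bound (a b α t0 : ℝ) (ha : 0 < a) (hb : 0 < b) (hα : 1 < α) (hα2 : α < 2)
    (ht0 : 0 < t0) :
    ∃ κ K : ℝ, 0 < κ ∧ ∀ ξ : ℝ, ξ ≠ 0 → ∀ t : ℝ, t0 ≤ t →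
      ‖Complex.exp (-(a : ℂ) * ∫ s in (0:ℝ)..t, vC b α s (-Complex.I * (ξ : ℂ)))‖ ≤
        K * Real.exp (-κ * |ξ| ^ (2 - α)) := by
  obtain ⟨κ, D, hκ, H⟩ := vC_lower b α t0 hb hα hα2 ht0
  refine ⟨a * κ, Real.exp (a * D), by positivity, ?_⟩
  intro ξ hξ t ht
  have := mul_le_mul_of_nonneg_left (H ξ hξ t ht) ha.le
  rw [Complex.norm_exp, ← Real.exp_add]
  apply Real.exp_le_exp.2
  rw [← Complex.ofReal_neg, Complex.re_ofReal_mul]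
  nlinarith

lemma integrable_bound (κ p : ℝ) (n : ℕ) (hκ : 0 < κ) (hp : 0 < p) :
    Integrable (fun ξ : ℝ => |ξ| ^ n * Real.exp (-κ * |ξ| ^ p)) := by
  have h0 : IntegrableOn (fun ξ : ℝ => |ξ| ^ n * Real.exp (-κ * |ξ| ^ p)) (Set.Ioi 0) := by
    refine (integrableOn_rpow_mul_exp_neg_mul_rpow (s := n) (p := p) (b := κ)
      (by have := n.cast_nonneg (α := ℝ); linarith) hp hκ).congr_fun ?_ measurableSet_Ioi
    intro x hx
    simp only [abs_of_pos (show 0 < x from hx), Real.rpow_natCast]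
  rw [← integrableOn_univ, ← @Set.Iio_union_Ici _ _ (0 : ℝ), integrableOn_union,
    integrableOn_Ici_iff_integrableOn_Ioi]
  refine ⟨?_, h0⟩
  have := h0.comp_neg
  simpa using this

lemma meas_F (a b α t : ℝ) (ht : 0 ≤ t) :
    StronglyMeasurable (fun ξ : ℝ =>
      Complex.exp (-(a : ℂ) * ∫ s in (0:ℝ)..t, vC b α s (-Complex.I * (ξ : ℂ)))) := by
  simp_rw [intervalIntegral.integral_of_le ht]
  have h : Measurable (fun p : ℝ × ℝ => vC b α p.2 (-Complex.I * (p.1 : ℂ))) := by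
    unfold vC
    fun_prop
  have h2 := h.stronglyMeasurable.integral_prod_right' (ν := volume.restrict (Set.Ioc 0 t))
  exact (Complex.measurable_exp.comp (h2.measurable.const_mul _)).stronglyMeasurable

lemma ae_ne : ∀ᵐ ξ : ℝ, ξ ≠ 0 := by
  simp [ae_iff]

lemma int_F (a b α : ℝ) (ha : 0 < a) (hb : 0 < b) (hα : 1 < α) (hα2 : α < 2) (t : ℝ)
    (ht : 0 < t) (n : ℕ) :
    Integrable (fun ξ : ℝ => ‖ξ‖ ^ n * ‖Complex.exp (-(a : ℂ) *
      ∫ s in (0:ℝ)..t, vC b α s (-Complex.I * (ξ : ℂ)))‖) := by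
  obtain ⟨κ, K, hκ, H⟩ := exp_bound a b α t ha hb hα hα2 ht
  refine ((integrable_bound κ (2 - α) n hκ (by linarith)).const_mul K).mono' ?_ ?_
  · exact ((continuous_norm.pow n).stronglyMeasurable.mul
      (meas_F a b α t ht.le).norm).aestronglyMeasurable
  · filter_upwards [ae_ne] with ξ hξ
    have := mul_le_mul_of_nonneg_left (H ξ hξ t le_rfl) (pow_nonneg (abs_nonneg ξ) n)
    rw [norm_mul, norm_norm, norm_pow, norm_norm, Real.norm_eq_abs]
    linarith

lemma norm_char (x ξ : ℝ) : ‖Complex.exp (-Complex.I * (x : ℂ) * (ξ : ℂ))‖ = 1 := by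
  rw [Complex.norm_exp]; simp

theorem stmt_7 (a b α : ℝ) (ha : 0 < a) (hb : 0 < b) (hα : 1 < α) (hα2 : α < 2) :
    (∀ t : ℝ, 0 < t → ∀ x : ℝ,
      Integrable (fun ξ : ℝ => Complex.exp (-Complex.I * (x : ℂ) * (ξ : ℂ)) *
        Complex.exp (-(a : ℂ) * ∫ s in (0:ℝ)..t, vC b α s (-Complex.I * (ξ : ℂ))))) ∧
    ContinuousOn (fun p : ℝ × ℝ => fDen a b α p.1 p.2) (Set.Ioi (0:ℝ) ×ˢ Set.univ) ∧
    (∀ t : ℝ, 0 < t → ContDiff ℝ (⊤ : ℕ∞) (fun x : ℝ => fDen a b α t x)) := by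
  have hmeas : ∀ t : ℝ, 0 ≤ t → ∀ x : ℝ, AEStronglyMeasurable
      (fun ξ : ℝ => Complex.exp (-Complex.I * (x : ℂ) * (ξ : ℂ)) *
        Complex.exp (-(a : ℂ) * ∫ s in (0:ℝ)..t, vC b α s (-Complex.I * (ξ : ℂ)))) := by
    intro t ht x
    have : Continuous (fun ξ : ℝ => Complex.exp (-Complex.I * (x : ℂ) * (ξ : ℂ))) := by fun_prop
    exact (this.stronglyMeasurable.mul (meas_F a b α t ht)).aestronglyMeasurable
  refine ⟨?_, ?_, ?_⟩
  · intro t ht x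
    refine (int_F a b α ha hb hα hα2 t ht 0).mono' (hmeas t ht.le x) ?_
    filter_upwards with ξ
    rw [norm_mul, norm_char, pow_zero]
  · rintro ⟨t, x⟩ ⟨ht, -⟩
    replace ht : 0 < t := ht
    apply ContinuousAt.continuousWithinAt
    unfold fDen
    refine continuousAt_const.mul ?_
    obtain ⟨κ, K, hκ, H⟩ := exp_bound a b α (t / 2) ha hb hα hα2 (by linarith)
    have hev : ∀ᶠ p : ℝ × ℝ in nhds (t, x), t / 2 < p.1 :=
      continuousAt_fst.eventually (lt_mem_nhds (by simpa using ht))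
    refine continuousAt_of_dominated
      (bound := fun ξ => K * (|ξ| ^ 0 * Real.exp (-κ * |ξ| ^ (2 - α)))) ?_ ?_ ?_ ?_
    · filter_upwards [hev] with p hp
      exact hmeas p.1 (by linarith) p.2
    · filter_upwards [hev] with p hp
      filter_upwards [ae_ne] with ξ hξ
      rw [norm_mul, norm_char, pow_zero, one_mul, one_mul]
      exact H ξ hξ _ hp.le
    · exact (integrable_bound κ (2 - α) 0 hκ (by linarith)).const_mul K
    · filter_upwards [ae_ne] with ξ hξ
      have hcont : Continuous (fun s : ℝ => vC b α (max s 0) (-Complex.I * (ξ : ℂ))) :=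
        (vC_cont b α ξ hb hα hα2 hξ).comp_continuous (by fun_prop) (fun s => Set.mem_Ici.2 (le_max_right _ _))
      have hprim := intervalIntegral.continuous_primitive
        (fun u v => hcont.intervalIntegrable (μ := volume) u v) 0
      have hc : ContinuousAt (fun p : ℝ × ℝ =>
          Complex.exp (-Complex.I * (p.2 : ℂ) * (ξ : ℂ)) * Complex.exp (-(a : ℂ) *
            ∫ s in (0:ℝ)..p.1, vC b α (max s 0) (-Complex.I * (ξ : ℂ)))) (t, x) := by
        refine Continuous.continuousAt ?_
        have := hprim.comp (continuous_fst (X := ℝ) (Y := ℝ))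
        simp only [Function.comp_def] at this
        fun_prop
      refine hc.congr ?_
      filter_upwards [hev] with p hp
      congr 3
      refine intervalIntegral.integral_congr ?_
      intro s hs
      rw [Set.uIcc_of_le (by linarith)] at hs
      simp only [max_eq_left hs.1]
  · intro t ht
    have h := Real.contDiff_fourier (N := ⊤)
      (fun n _ => int_F a b α ha hb hα hα2 t ht n)
    have h2 := (contDiff_const (c := ((1 / (2 * Real.pi) : ℝ) : ℂ))).mul
      (h.comp (contDiff_id.div_const (2 * Real.pi)))
    refine Eq.mpr (congrArg (fun g : ℝ → ℂ => ContDiff ℝ (⊤ : ℕ∞) g) ?_) h2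
    funext x
    unfold fDen
    simp only [Function.comp_def, Real.fourier_real_eq_integral_exp_smul, smul_eq_mul, id]
    congr 2
    ext ξ
    congr 2
    have : (Real.pi : ℂ) ≠ 0 := by exact_mod_cast Real.pi_ne_zero
    push_cast
    field_simp
end

section
/- Let a>0, b>0 and α∈(1,2). Then for every t>0 and every x>0, the function f admits the real-integral representation f(t,x) = (1/π) ∫₀^{∞} e^{−xz} · ( −Im( exp( −a ∫₀^t v_s(−z) ds ) ) ) dz, where for z>0 the value v_s(−z) is computed with the principal branch (Arg(−z) = π). -/
open Real MeasureTheory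

noncomputable def WW (g k c s : ℝ) (ω : ℂ) : ℂ :=
  Complex.exp (-(g : ℂ) * ω) * ((Real.exp (k * s) : ℝ) : ℂ) + ((c * (Real.exp (k * s) - 1) : ℝ) : ℂ)

lemma WW_slit {g k c s : ℝ} (hg : 0 < g) (hk : 0 < k) (hc : 0 < c) (hs : 0 ≤ s) {ω : ℂ}
    (h1 : -π < g * ω.im) (h2 : g * ω.im < π) : WW g k c s ω ∈ Complex.slitPlane := by
  have hE : 1 ≤ Real.exp (k * s) := Real.one_le_exp (by positivity)
  have hre : (WW g k c s ω).re = Real.exp (-g * ω.re) * Real.cos (g * ω.im) * Real.exp (k * s)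
      + c * (Real.exp (k * s) - 1) := by
    unfold WW
    rw [Complex.add_re, Complex.re_mul_ofReal, Complex.exp_re, Complex.ofReal_re]
    simp
  have him : (WW g k c s ω).im = -(Real.exp (-g * ω.re) * Real.sin (g * ω.im) * Real.exp (k * s)) := by
    unfold WW
    rw [Complex.add_im, Complex.im_mul_ofReal, Complex.exp_im, Complex.ofReal_im]
    simp
  rw [Complex.mem_slitPlane_iff]
  by_cases h : Real.sin (g * ω.im) = 0
  · left
    have : g * ω.im = 0 := (Real.sin_eq_zero_iff_of_lt_of_lt h1 h2).1 h
    rw [hre, this, Real.cos_zero]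
    have : 0 ≤ c * (Real.exp (k * s) - 1) := mul_nonneg hc.le (by linarith)
    positivity
  · right
    rw [him]
    have := (Real.exp_pos (-g * ω.re)).ne'
    have := (Real.exp_pos (k*s)).ne'
    simp only [ne_eq, neg_eq_zero, mul_eq_zero]
    tauto

lemma WW_lower {g k c s : ℝ} (hg : 0 < g) (hg1 : g < 1) (hk : 0 < k) (hc : 0 < c) (hs : 0 ≤ s) {ω : ℂ}
    (h : |ω.im| ≤ π) :
    Real.cos (g * π / 2) * (Real.exp (-g * ω.re) + c * k * s) ≤ ‖WW g k c s ω‖ := by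
  have hE : k * s + 1 ≤ Real.exp (k * s) := Real.add_one_le_exp _
  have hks : 0 ≤ k * s := by positivity
  have hpi := Real.pi_pos
  set φ : ℝ := g * ω.im / 2 with hφ
  have hφabs : |φ| ≤ g * π / 2 := by
    rw [hφ, abs_div, abs_mul, abs_of_pos hg, abs_two]
    gcongr
  have hcos : Real.cos (g * π / 2) ≤ Real.cos φ := by
    rw [← Real.cos_abs φ]
    apply Real.cos_le_cos_of_nonneg_of_le_pi (abs_nonneg _) _ hφabs
    nlinarith
  have hcos0 : 0 ≤ Real.cos (g * π / 2) :=
    Real.cos_nonneg_of_mem_Icc ⟨by nlinarith, by nlinarith⟩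
  have e1 : (Complex.exp (φ * Complex.I) * WW g k c s ω).re =
      Real.exp (-g * ω.re) * Real.cos φ * Real.exp (k * s) + c * (Real.exp (k * s) - 1) * Real.cos φ := by
    unfold WW
    rw [mul_add, ← mul_assoc, ← Complex.exp_add, Complex.add_re, Complex.re_mul_ofReal,
      Complex.re_mul_ofReal, Complex.exp_re, Complex.exp_re]
    have : ((φ:ℂ) * Complex.I + -(g:ℂ) * ω).im = -φ := by simp [hφ]; ring
    rw [this, Real.cos_neg]
    simp
    ring
  have e2 : ‖Complex.exp (φ * Complex.I) * WW g k c s ω‖ = ‖WW g k c s ω‖ := by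
    rw [norm_mul, Complex.norm_exp_ofReal_mul_I, one_mul]
  rw [← e2]
  refine le_trans ?_ (Complex.re_le_norm _)
  rw [e1]
  have hexp := Real.exp_pos (-g * ω.re)
  calc Real.cos (g * π / 2) * (Real.exp (-g * ω.re) + c * k * s)
      ≤ Real.cos φ * (Real.exp (-g * ω.re) * Real.exp (k * s) + c * (Real.exp (k * s) - 1)) := by
        apply mul_le_mul hcos _ (by positivity) (hcos0.trans hcos)
        nlinarith
    _ = _ := by ring

lemma WW_hasDerivAt {g k c : ℝ} (s : ℝ) (ω : ℂ) :
    HasDerivAt (fun s : ℝ => WW g k c s ω) ((k : ℂ) * (WW g k c s ω + c)) s := by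
  have h1 : HasDerivAt (fun s : ℝ => Real.exp (k * s)) (Real.exp (k * s) * k) s := by
    simpa using ((hasDerivAt_id s).const_mul k).exp
  have h2 : HasDerivAt (fun s : ℝ => ((Real.exp (k * s) : ℝ) : ℂ)) ((Real.exp (k * s) * k : ℝ) : ℂ) s :=
    h1.ofReal_comp
  have h3 : HasDerivAt (fun s : ℝ => ((c * (Real.exp (k * s) - 1) : ℝ) : ℂ))
    ((c * (Real.exp (k * s) * k) : ℝ) : ℂ) s := ((h1.sub_const 1).const_mul c).ofReal_comp
  have := (h2.const_mul (Complex.exp (-(g:ℂ) * ω))).add h3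
  unfold WW
  refine HasDerivAt.congr_deriv this ?_
  push_cast
  ring

lemma WW_zero {g k c : ℝ} (ω : ℂ) : WW g k c 0 ω = Complex.exp (-(g : ℂ) * ω) := by
  simp [WW]

/-- The exact identity. -/
lemma V_identity {g k c t : ℝ} (hg : 0 < g) (hg1 : g < 1) (hk : 0 < k) (hc : 0 < c) (ht : 0 < t) {ω : ℂ}
    (h : |ω.im| ≤ π) :
    ((k * c * ((1 - g) / g) : ℝ) : ℂ) * ∫ s in (0:ℝ)..t, WW g k c s ω ^ ((-(1 / g) : ℝ) : ℂ) =
      Complex.exp (((1 - g : ℝ) : ℂ) * ω) - WW g k c t ω ^ ((-((1 - g) / g) : ℝ) : ℂ)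
       - ((k * ((1 - g) / g) : ℝ) : ℂ) * ∫ s in (0:ℝ)..t, WW g k c s ω ^ ((-((1 - g) / g) : ℝ) : ℂ) := by
  have hpi := Real.pi_pos
  have hab := abs_le.1 h
  have him1 : -π < g * ω.im := by nlinarith
  have him2 : g * ω.im < π := by nlinarith
  have hsl : ∀ s, 0 ≤ s → WW g k c s ω ∈ Complex.slitPlane := fun s hs => WW_slit hg hk hc hs him1 him2
  have hcont : Continuous (fun s : ℝ => WW g k c s ω) :=
    continuous_iff_continuousAt.2 fun s => (WW_hasDerivAt s ω).continuousAt
  have hci : ∀ p : ℂ, IntervalIntegrable (fun s : ℝ => WW g k c s ω ^ p) volume 0 t := by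
    intro p
    apply ContinuousOn.intervalIntegrable
    apply hcont.continuousOn.cpow_const
    intro s hs
    rw [Set.uIcc_of_le ht.le] at hs
    exact hsl s hs.1
  have hd : ∀ s ∈ Set.uIcc 0 t, HasDerivAt (fun s : ℝ => WW g k c s ω ^ ((-((1 - g) / g) : ℝ) : ℂ))
      (-((k * ((1 - g) / g) : ℝ) : ℂ) * WW g k c s ω ^ ((-((1 - g) / g) : ℝ) : ℂ)
       - ((k * c * ((1 - g) / g) : ℝ) : ℂ) * WW g k c s ω ^ ((-(1 / g) : ℝ) : ℂ)) s := by
    intro s hs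
    rw [Set.uIcc_of_le ht.le] at hs
    have hs0 := hsl s hs.1
    have := (HasDerivAt.comp_of_eq s (Complex.hasStrictDerivAt_cpow_const (c := ((-((1 - g) / g) : ℝ) : ℂ)) hs0).hasDerivAt (WW_hasDerivAt s ω) rfl)
    refine HasDerivAt.congr_deriv this ?_
    have hne := Complex.slitPlane_ne_zero hs0
    have e1 : (((-((1 - g) / g) : ℝ) : ℂ) - 1) = ((-(1 / g) : ℝ) : ℂ) := by
      rw [← Complex.ofReal_one, ← Complex.ofReal_sub]; congr 1; field_simp; ring
    have e2 : WW g k c s ω ^ ((-((1 - g) / g) : ℝ) : ℂ) =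
        WW g k c s ω ^ ((-(1 / g) : ℝ) : ℂ) * WW g k c s ω := by
      rw [← e1, Complex.cpow_sub _ _ hne, Complex.cpow_one]; field_simp
    rw [e1, e2]
    push_cast
    ring
  have := intervalIntegral.integral_eq_sub_of_hasDerivAt hd
    (((hci _).const_mul _).sub ((hci _).const_mul _))
  rw [intervalIntegral.integral_sub ((hci _).const_mul _) ((hci _).const_mul _),
    intervalIntegral.integral_const_mul, intervalIntegral.integral_const_mul, WW_zero] at this
  have e3 : Complex.exp (-(g : ℂ) * ω) ^ ((-((1 - g) / g) : ℝ) : ℂ) =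
      Complex.exp (((1 - g : ℝ) : ℂ) * ω) := by
    rw [Complex.cpow_def_of_ne_zero (Complex.exp_ne_zero _), Complex.log_exp]
    · congr 1
      have : (g : ℂ) ≠ 0 := by exact_mod_cast hg.ne'
      push_cast; field_simp
    · simp; linarith
    · simp; linarith
  rw [e3] at this
  linear_combination -this

lemma U_bound {g k c s : ℝ} (hg : 0 < g) (hg1 : g < 1) (hk : 0 < k) (hc : 0 < c) (hs : 0 < s) {ω : ℂ}
    (h : |ω.im| ≤ π) :
    ‖WW g k c s ω ^ ((-((1 - g) / g) : ℝ) : ℂ)‖ ≤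
      (Real.cos (g * π / 2)) ^ (-((1 - g) / g)) * (c * k) ^ (-(1 - g)) *
        Real.exp ((1 - g) * (1 - g) * ω.re) * s ^ (-(1 - g)) := by
  have hpi := Real.pi_pos
  have hcos0 : 0 < Real.cos (g * π / 2) :=
    Real.cos_pos_of_mem_Ioo ⟨by nlinarith, by nlinarith⟩
  rw [Complex.norm_cpow_real]
  have hl := WW_lower hg hg1 hk hc hs.le h
  set A := Real.exp (-g * ω.re) with hA
  have hApos : 0 < A := Real.exp_pos _
  have hY : 0 < c * k * s := by positivity
  have hgm : A ^ (1 - g) * (c * k * s) ^ g ≤ A + c * k * s := by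
    have := Real.geom_mean_le_arith_mean2_weighted (by linarith : 0 ≤ 1 - g) hg.le hApos.le hY.le (by ring)
    nlinarith
  have hl2 : Real.cos (g * π / 2) * (A ^ (1 - g) * (c * k * s) ^ g) ≤ ‖WW g k c s ω‖ :=
    le_trans (by gcongr) hl
  have hneg : -((1 - g) / g) ≤ 0 := by
    have : 0 ≤ (1 - g) / g := div_nonneg (by linarith) hg.le
    linarith
  refine (Real.rpow_le_rpow_of_nonpos (by positivity) hl2 hneg).trans (le_of_eq ?_)
  rw [Real.mul_rpow hcos0.le (by positivity), Real.mul_rpow (by positivity) (by positivity),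
    ← Real.rpow_mul hApos.le, ← Real.rpow_mul hY.le]
  have : g * -((1 - g) / g) = -(1 - g) := by field_simp
  rw [this, Real.mul_rpow (by positivity) hs.le, hA, ← Real.exp_mul]
  have : -g * ω.re * ((1 - g) * -((1 - g) / g)) = (1 - g) * (1 - g) * ω.re := by field_simp
  rw [this]; ring

lemma U_bound' {g k c s : ℝ} (hg : 0 < g) (hg1 : g < 1) (hk : 0 < k) (hc : 0 < c) (hs : 0 < s) {ω : ℂ}
    (h : |ω.im| ≤ π) :
    ‖WW g k c s ω ^ ((-((1 - g) / g) : ℝ) : ℂ)‖ ≤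
      (Real.cos (g * π / 2) * (c * k * s)) ^ (-((1 - g) / g)) := by
  have hpi := Real.pi_pos
  have hcos0 : 0 < Real.cos (g * π / 2) :=
    Real.cos_pos_of_mem_Ioo ⟨by nlinarith, by nlinarith⟩
  rw [Complex.norm_cpow_real]
  have hl := WW_lower hg hg1 hk hc hs.le h
  have hneg : -((1 - g) / g) ≤ 0 := by
    have : 0 ≤ (1 - g) / g := div_nonneg (by linarith) hg.le
    linarith
  refine Real.rpow_le_rpow_of_nonpos (by positivity) (le_trans ?_ hl) hneg
  have := Real.exp_pos (-g * ω.re)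
  gcongr
  linarith

/-- Lower bound on the real part. -/
lemma V_lower {g k c t : ℝ} (hg : 0 < g) (hg1 : g < 1) (hk : 0 < k) (hc : 0 < c) (ht : 0 < t) :
    ∃ A > 0, ∃ C ≥ 0, ∀ ω : ℂ, |ω.im| ≤ π →
      A * (Real.exp ((1 - g) * ω.re) * Real.cos ((1 - g) * ω.im)) - C - C * Real.exp ((1 - g) * (1 - g) * ω.re) ≤
       (∫ s in (0:ℝ)..t, WW g k c s ω ^ ((-(1 / g) : ℝ) : ℂ)).re := by
  have hpi := Real.pi_pos
  have hcos0 : 0 < Real.cos (g * π / 2) :=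
    Real.cos_pos_of_mem_Ioo ⟨by nlinarith, by nlinarith⟩
  set β := (1 - g) / g with hβ
  have hβ0 : 0 < β := div_pos (by linarith) hg
  set M := (Real.cos (g * π / 2)) ^ (-β) * (c * k) ^ (-(1 - g)) with hM
  have hM0 : 0 ≤ M := by positivity
  set T := (Real.cos (g * π / 2) * (c * k * t)) ^ (-β) with hT
  have hT0 : 0 ≤ T := by positivity
  set S := ∫ s in (0:ℝ)..t, s ^ (-(1 - g)) with hS
  have hS0 : 0 ≤ S := intervalIntegral.integral_nonneg ht.le (fun s hs => by have := hs.1; positivity)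
  refine ⟨1 / (k * c * β), by positivity, T / (k * c * β) + M * S / c, by positivity, ?_⟩
  intro ω h
  have hid := V_identity hg hg1 hk hc ht h
  rw [← hβ] at hid
  have hInteg : ‖∫ s in (0:ℝ)..t, WW g k c s ω ^ ((-β : ℝ) : ℂ)‖ ≤
      M * Real.exp ((1 - g) * (1 - g) * ω.re) * S := by
    rw [hS, ← intervalIntegral.integral_const_mul]
    apply intervalIntegral.norm_integral_le_of_norm_le ht.le
    · filter_upwards with s hs
      exact U_bound hg hg1 hk hc hs.1 h
    · exact (intervalIntegral.intervalIntegrable_rpow' (by linarith)).const_mul _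
  have hre := congrArg Complex.re hid
  rw [Complex.sub_re, Complex.sub_re, Complex.re_ofReal_mul, Complex.re_ofReal_mul, Complex.exp_re,
    Complex.re_ofReal_mul, Complex.im_ofReal_mul] at hre
  have b1 := (Complex.re_le_norm _).trans (U_bound' hg hg1 hk hc ht h)
  rw [← hβ, ← hT] at b1
  have b2 := (Complex.re_le_norm _).trans hInteg
  set X := (∫ s in (0:ℝ)..t, WW g k c s ω ^ ((-(1 / g) : ℝ) : ℂ)).re
  set Y := (∫ s in (0:ℝ)..t, WW g k c s ω ^ ((-β : ℝ) : ℂ)).re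
  set Z := (WW g k c t ω ^ ((-β : ℝ) : ℂ)).re
  set P := Real.exp ((1 - g) * ω.re) * Real.cos ((1 - g) * ω.im)
  set Q := Real.exp ((1 - g) * (1 - g) * ω.re) with hQ
  have hQ0 : 0 < Q := Real.exp_pos _
  have hX : X = 1 / (k * c * β) * P - Z / (k * c * β) - Y / c := by
    field_simp
    linear_combination hre
  rw [hX]
  have i1 : Z / (k * c * β) ≤ T / (k * c * β) := by gcongr
  have i2 : Y / c ≤ M * S / c * Q := by
    rw [div_mul_eq_mul_div]
    apply div_le_div_of_nonneg_right _ hc.le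
    linarith
  have i3 : 0 ≤ T / (k * c * β) * Q := by positivity
  have i4 : 0 ≤ M * S / c := by positivity
  nlinarith

lemma pow_absorb {K ε p q : ℝ} (hK : 0 ≤ K) (hε : 0 < ε) (hp : 0 < p) (hpq : p < q) :
    ∃ C ≥ 0, ∀ ρ : ℝ, K * Real.exp (p * ρ) ≤ C + ε * Real.exp (q * ρ) := by
  set ρ0 := Real.log (K / ε + 1) / (q - p) with hρ0
  have hqp : 0 < q - p := by linarith
  have hexp : Real.exp ((q - p) * ρ0) = K / ε + 1 := by
    rw [hρ0, mul_div_cancel₀ _ hqp.ne', Real.exp_log (by positivity)]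
  refine ⟨K * Real.exp (p * ρ0), by positivity, fun ρ => ?_⟩
  rcases le_total ρ ρ0 with h | h
  · have : Real.exp (p * ρ) ≤ Real.exp (p * ρ0) := Real.exp_le_exp.2 (by nlinarith)
    have := mul_le_mul_of_nonneg_left this hK
    have : 0 < ε * Real.exp (q * ρ) := by positivity
    linarith
  · have h1 : Real.exp ((q - p) * ρ0) ≤ Real.exp ((q - p) * ρ) := Real.exp_le_exp.2 (by nlinarith)
    rw [hexp] at h1
    have h2 : Real.exp (q * ρ) = Real.exp ((q - p) * ρ) * Real.exp (p * ρ) := by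
      rw [← Real.exp_add]; congr 1; ring
    have h3 : K ≤ ε * Real.exp ((q - p) * ρ) := by
      have := mul_le_mul_of_nonneg_left h1 hε.le
      rw [mul_add, mul_div_cancel₀ _ hε.ne'] at this
      linarith
    have h4 := mul_le_mul_of_nonneg_right h3 (Real.exp_pos (p * ρ)).le
    rw [h2]
    have : 0 ≤ K * Real.exp (p * ρ0) := by positivity
    nlinarith

noncomputable def VV (g k c t : ℝ) (ω : ℂ) : ℂ :=
  ∫ s in (0:ℝ)..t, WW g k c s ω ^ ((-(1 / g) : ℝ) : ℂ)

noncomputable def HH (a x g k c t : ℝ) (ω : ℂ) : ℂ :=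
  Complex.exp ((x : ℂ) * Complex.exp ω) * Complex.exp (-(a : ℂ) * VV g k c t ω)

lemma HH_bound {a x g k c t : ℝ} (ha : 0 < a) (hx : 0 < x) (hg : 0 < g) (hg1 : g < 1) (hk : 0 < k)
    (hc : 0 < c) (ht : 0 < t) :
    ∃ C : ℝ, ∃ δ > 0, ∀ ω : ℂ, π / 2 ≤ ω.im → ω.im ≤ π →
      ‖HH a x g k c t ω‖ ≤ Real.exp (C - δ * Real.exp ((1 - g) * ω.re)) := by
  have hpi := Real.pi_pos
  obtain ⟨A, hA, C1, hC1, hV⟩ := V_lower hg hg1 hk hc ht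
  set κ := 1 - g with hκ
  have hκ0 : 0 < κ := by linarith
  have hκ1 : κ < 1 := by linarith
  set c0 := Real.cos (κ * (π / 2)) with hc0
  have hc0pos : 0 < c0 := Real.cos_pos_of_mem_Ioo ⟨by nlinarith, by nlinarith⟩
  obtain ⟨C2, hC2, h2⟩ := pow_absorb (K := a * C1) (ε := a * A * c0 / 2) (p := κ * κ) (q := κ)
    (by positivity) (by positivity) (by positivity) (by nlinarith)
  obtain ⟨C3, hC3, h3⟩ := pow_absorb (K := a * A * κ) (ε := 2 * x / π) (p := κ) (q := 1)
    (by positivity) (by positivity) (by positivity) hκ1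
  refine ⟨a * C1 + C2 + π / 2 * C3, a * A * c0 / 2, by positivity, fun ω hl hu => ?_⟩
  have hVω := hV ω (abs_le.2 ⟨by linarith, hu⟩)
  unfold HH
  rw [← Complex.exp_add, Complex.norm_exp]
  apply Real.exp_le_exp.2
  have hre : ((x : ℂ) * Complex.exp ω + -(a : ℂ) * VV g k c t ω).re =
      x * (Real.exp ω.re * Real.cos ω.im) - a * (VV g k c t ω).re := by
    rw [Complex.add_re, Complex.re_ofReal_mul, Complex.exp_re, ← Complex.ofReal_neg,
      Complex.re_ofReal_mul]
    ring
  rw [hre]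
  change _ ≤ (VV g k c t ω).re at hVω
  set φ := ω.im - π / 2 with hφ
  have hφ0 : 0 ≤ φ := by linarith
  have hφ1 : φ ≤ π / 2 := by linarith
  have hcos1 : Real.cos ω.im ≤ - (2 / π * φ) := by
    have : ω.im = φ + π / 2 := by ring
    rw [this, Real.cos_add_pi_div_two]
    have := Real.mul_le_sin hφ0 hφ1
    linarith
  have hcos2 : c0 - κ * φ ≤ Real.cos (κ * ω.im) := by
    have hL := Real.abs_cos_sub_cos_le (κ * (π / 2)) (κ * ω.im)
    have e : |κ * (π / 2) - κ * ω.im| = κ * φ := by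
      rw [abs_sub_comm, ← mul_sub, abs_of_nonneg (by positivity)]
    rw [e] at hL
    have := (abs_le.1 hL).2
    linarith
  have h2' := h2 ω.re
  have h3' := h3 ω.re
  rw [one_mul] at h3'
  have hR := Real.exp_pos ω.re
  have hRκ := Real.exp_pos (κ * ω.re)
  set R := Real.exp ω.re
  set Rκ := Real.exp (κ * ω.re)
  set Q := Real.exp (κ * κ * ω.re)
  have i1 : x * (R * Real.cos ω.im) ≤ x * (R * (- (2 / π * φ))) := by gcongr
  have i2 : a * (A * (Rκ * (c0 - κ * φ))) ≤ a * (A * (Rκ * Real.cos (κ * ω.im))) := by gcongr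
  have i3 : a * (A * (Rκ * Real.cos (κ * ω.im)) - C1 - C1 * Q) ≤ a * (VV g k c t ω).re := by gcongr
  have i4 : φ * (a * A * κ * Rκ) ≤ φ * (C3 + 2 * x / π * R) := by gcongr
  have i5 : φ * C3 ≤ π / 2 * C3 := by gcongr
  have i6 : x * (R * (- (2 / π * φ))) = - (φ * (2 * x / π * R)) := by ring
  nlinarith

lemma WW_hasDerivAt_ω {g k c s : ℝ} (ω : ℂ) :
    HasDerivAt (fun ω : ℂ => WW g k c s ω)
      (Complex.exp (-(g : ℂ) * ω) * (-(g : ℂ)) * ((Real.exp (k * s) : ℝ) : ℂ)) ω := by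
  unfold WW
  apply HasDerivAt.add_const
  apply HasDerivAt.mul_const
  apply HasDerivAt.cexp
  have := (hasDerivAt_id ω).const_mul (-(g : ℂ))
  rw [mul_one] at this
  exact this

lemma WW_cont {g k c : ℝ} : Continuous (fun p : ℂ × ℝ => WW g k c p.2 p.1) := by
  unfold WW
  fun_prop

lemma VV_diff {g k c t : ℝ} (hg : 0 < g) (hk : 0 < k) (hc : 0 < c) (ht : 0 < t) {ω₀ : ℂ}
    (h1 : -π < g * ω₀.im) (h2 : g * ω₀.im < π) : DifferentiableAt ℂ (VV g k c t) ω₀ := by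
  have hopen : IsOpen {ω : ℂ | -π < g * ω.im ∧ g * ω.im < π} := by
    apply IsOpen.and
    · exact isOpen_lt (by fun_prop) (by fun_prop)
    · exact isOpen_lt (by fun_prop) (by fun_prop)
  obtain ⟨r, hr, hball⟩ := Metric.nhds_basis_closedBall.mem_iff.1 (hopen.mem_nhds ⟨h1, h2⟩)
  have hsl : ∀ ω ∈ Metric.closedBall ω₀ r, ∀ s, 0 ≤ s → WW g k c s ω ∈ Complex.slitPlane :=
    fun ω hω s hs => WW_slit hg hk hc hs (hball hω).1 (hball hω).2
  set F' : ℂ → ℝ → ℂ := fun ω s => ((-(1 / g) : ℝ) : ℂ) * WW g k c s ω ^ (((-(1 / g) : ℝ) : ℂ) - 1) *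
    (Complex.exp (-(g : ℂ) * ω) * (-(g : ℂ)) * ((Real.exp (k * s) : ℝ) : ℂ)) with hF'
  have hF'c : ContinuousOn (fun p : ℂ × ℝ => F' p.1 p.2) (Metric.closedBall ω₀ r ×ˢ Set.Icc 0 t) := by
    apply ContinuousOn.mul
    · apply ContinuousOn.mul continuousOn_const
      apply WW_cont.continuousOn.cpow_const
      rintro ⟨ω, s⟩ ⟨hω, hs⟩
      exact hsl ω hω s hs.1
    · apply Continuous.continuousOn
      fun_prop
  obtain ⟨B, hB⟩ := ((isCompact_closedBall ω₀ r).prod isCompact_Icc).exists_bound_of_continuousOn hF'c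
  have hFc : ∀ ω ∈ Metric.closedBall ω₀ r, ContinuousOn
      (fun s : ℝ => WW g k c s ω ^ ((-(1 / g) : ℝ) : ℂ)) (Set.Icc 0 t) := by
    intro ω hω
    apply ContinuousOn.cpow_const
    · exact (WW_cont.comp (by fun_prop : Continuous fun s : ℝ => (ω, s))).continuousOn
    · intro s hs
      exact hsl ω hω s hs.1
  have hsub : Set.uIoc 0 t ⊆ Set.Icc 0 t := by
    rw [Set.uIoc_of_le ht.le]; exact Set.Ioc_subset_Icc_self
  have key := intervalIntegral.hasDerivAt_integral_of_dominated_loc_of_deriv_le (𝕜 := ℂ) (μ := volume)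
    (a := 0) (b := t) (bound := fun _ => B)
    (F := fun ω s => WW g k c s ω ^ ((-(1 / g) : ℝ) : ℂ)) (F' := F') (x₀ := ω₀)
    (s := Metric.closedBall ω₀ r) (Metric.closedBall_mem_nhds _ hr) ?_ ?_ ?_ ?_ ?_ ?_
  · exact key.2.differentiableAt
  · filter_upwards [Metric.closedBall_mem_nhds ω₀ hr] with ω hω
    exact ((hFc ω hω).mono hsub).aestronglyMeasurable measurableSet_uIoc
  · apply ContinuousOn.intervalIntegrable
    rw [Set.uIcc_of_le ht.le]
    exact hFc ω₀ (Metric.mem_closedBall_self hr.le)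
  · have : ContinuousOn (F' ω₀) (Set.Icc 0 t) := by
      apply hF'c.comp (f := fun s : ℝ => (ω₀, s)) (by fun_prop)
      intro s hs
      exact ⟨Metric.mem_closedBall_self hr.le, hs⟩
    exact (this.mono hsub).aestronglyMeasurable measurableSet_uIoc
  · filter_upwards with s hs ω hω
    exact hB (ω, s) ⟨hω, hsub hs⟩
  · exact intervalIntegrable_const
  · filter_upwards with s hs ω hω
    exact HasDerivAt.comp_of_eq ω (Complex.hasStrictDerivAt_cpow_const
      (hsl ω hω s (hsub hs).1)).hasDerivAt (WW_hasDerivAt_ω ω) rfl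

lemma HH_diff {a x g k c t : ℝ} (hg : 0 < g) (hg1 : g < 1) (hk : 0 < k) (hc : 0 < c) (ht : 0 < t) {ω : ℂ}
    (h : |ω.im| ≤ π) : DifferentiableAt ℂ (HH a x g k c t) ω := by
  have hpi := Real.pi_pos
  have hab := abs_le.1 h
  have := VV_diff hg hk hc ht (ω₀ := ω) (by nlinarith) (by nlinarith)
  unfold HH
  fun_prop

/-- Contour shift in a horizontal strip. -/
lemma strip_shift {F : ℂ → ℂ} {y₁ y₂ : ℝ} (hy : y₁ ≤ y₂) {Ψ : ℝ → ℝ}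
    (hd : ∀ ω : ℂ, y₁ ≤ ω.im → ω.im ≤ y₂ → DifferentiableAt ℂ F ω)
    (hb : ∀ ω : ℂ, y₁ ≤ ω.im → ω.im ≤ y₂ → ‖F ω‖ ≤ Ψ ω.re)
    (hΨ : Integrable Ψ) (hΨ1 : Filter.Tendsto Ψ Filter.atTop (nhds 0))
    (hΨ2 : Filter.Tendsto Ψ Filter.atBot (nhds 0)) :
    Integrable (fun ρ : ℝ => F (ρ + y₁ * Complex.I)) ∧ Integrable (fun ρ : ℝ => F (ρ + y₂ * Complex.I)) ∧
    ∫ ρ : ℝ, F (ρ + y₁ * Complex.I) = ∫ ρ : ℝ, F (ρ + y₂ * Complex.I) := by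
  have hInteg : ∀ y, y₁ ≤ y → y ≤ y₂ → Integrable (fun ρ : ℝ => F (ρ + y * Complex.I)) := by
    intro y h1 h2
    refine hΨ.mono' ?_ ?_
    · apply Continuous.aestronglyMeasurable
      rw [continuous_iff_continuousAt]
      intro ρ
      have := (hd (ρ + y * Complex.I) (by simpa using h1) (by simpa using h2)).continuousAt
      exact ContinuousAt.comp (f := fun ρ : ℝ => (ρ + y * Complex.I : ℂ)) this (by fun_prop)
    · filter_upwards with ρ
      simpa using hb (ρ + y * Complex.I) (by simpa using h1) (by simpa using h2)
  have I1 := hInteg y₁ le_rfl hy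
  have I2 := hInteg y₂ hy le_rfl
  refine ⟨I1, I2, ?_⟩
  have t1 := intervalIntegral_tendsto_integral I1 Filter.tendsto_neg_atTop_atBot Filter.tendsto_id
  have t2 := intervalIntegral_tendsto_integral I2 Filter.tendsto_neg_atTop_atBot Filter.tendsto_id
  have t3 : Filter.Tendsto (fun T : ℝ => ∫ y : ℝ in y₁..y₂, F (T + y * Complex.I)) Filter.atTop (nhds 0) := by
    have hz : Filter.Tendsto (fun T : ℝ => Ψ T * |y₂ - y₁|) Filter.atTop (nhds 0) := by
      simpa using hΨ1.mul_const |y₂ - y₁|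
    refine squeeze_zero_norm (fun T => ?_) hz
    apply intervalIntegral.norm_integral_le_of_norm_le_const
    intro y hy'
    rw [Set.uIoc_of_le hy] at hy'
    simpa using hb (T + y * Complex.I) (by simpa using hy'.1.le) (by simpa using hy'.2)
  have t4 : Filter.Tendsto (fun T : ℝ => ∫ y : ℝ in y₁..y₂, F (T + y * Complex.I)) Filter.atBot (nhds 0) := by
    have hz : Filter.Tendsto (fun T : ℝ => Ψ T * |y₂ - y₁|) Filter.atBot (nhds 0) := by
      simpa using hΨ2.mul_const |y₂ - y₁|
    refine squeeze_zero_norm (fun T => ?_) hz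
    apply intervalIntegral.norm_integral_le_of_norm_le_const
    intro y hy'
    rw [Set.uIoc_of_le hy] at hy'
    simpa using hb (T + y * Complex.I) (by simpa using hy'.1.le) (by simpa using hy'.2)
  have t4' := t4.comp Filter.tendsto_neg_atTop_atBot
  have t5 := ((t1.sub t2).add (t3.const_smul Complex.I)).sub (t4'.const_smul Complex.I)
  have hzero : ∀ T : ℝ, (∫ x : ℝ in (-T)..T, F (x + y₁ * Complex.I)) - (∫ x : ℝ in (-T)..T, F (x + y₂ * Complex.I)) +
      Complex.I • (∫ y : ℝ in y₁..y₂, F (T + y * Complex.I)) -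
      Complex.I • (∫ y : ℝ in y₁..y₂, F ((-T : ℝ) + y * Complex.I)) = 0 := by
    intro T
    have := Complex.integral_boundary_rect_eq_zero_of_differentiableOn F ⟨-T, y₁⟩ ⟨T, y₂⟩ (by
      intro ω hω
      have := hω.2
      simp only [Set.mem_preimage, Set.uIcc_of_le hy] at this
      exact (hd ω this.1 this.2).differentiableWithinAt)
    simpa using this
  have hlim := tendsto_nhds_unique t5 (tendsto_const_nhds.congr (fun T => (hzero T).symm))
  simp only [smul_zero, add_zero, sub_zero] at hlim
  exact sub_eq_zero.1 hlim

/-- Exponential substitution on the whole line. -/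
lemma exp_subst (h : ℝ → ℂ) :
    ∫ r in Set.Ioi (0:ℝ), h r = ∫ ρ : ℝ, (Real.exp ρ : ℂ) * h (Real.exp ρ) := by
  have := integral_image_eq_integral_abs_deriv_smul (s := Set.univ) (f := Real.exp) (f' := Real.exp)
    MeasurableSet.univ (fun x _ => (Real.hasDerivAt_exp x).hasDerivWithinAt)
    Real.exp_injective.injOn h
  rw [Set.image_univ, Real.range_exp, Measure.restrict_univ] at this
  rw [this]
  congr 1; ext ρ
  rw [abs_of_pos (Real.exp_pos _), Complex.real_smul]

lemma exp_subst_int {E : Type*} [NormedAddCommGroup E] [NormedSpace ℝ E] (h : ℝ → E) :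
    IntegrableOn h (Set.Ioi (0:ℝ)) ↔ Integrable (fun ρ : ℝ => Real.exp ρ • h (Real.exp ρ)) := by
  have := integrableOn_image_iff_integrableOn_abs_deriv_smul (s := Set.univ) (f := Real.exp) (f' := Real.exp)
    MeasurableSet.univ (fun x _ => (Real.hasDerivAt_exp x).hasDerivWithinAt)
    Real.exp_injective.injOn h
  rw [Set.image_univ, Real.range_exp, integrableOn_univ] at this
  rw [this]
  simp only [abs_of_pos (Real.exp_pos _)]

lemma Psi_props {C δ κ : ℝ} (hδ : 0 < δ) (hκ : 0 < κ) :
    Integrable (fun ρ : ℝ => Real.exp (C - δ * Real.exp (κ * ρ)) * Real.exp ρ) ∧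
    Filter.Tendsto (fun ρ : ℝ => Real.exp (C - δ * Real.exp (κ * ρ)) * Real.exp ρ) Filter.atTop (nhds 0) ∧
    Filter.Tendsto (fun ρ : ℝ => Real.exp (C - δ * Real.exp (κ * ρ)) * Real.exp ρ) Filter.atBot (nhds 0) := by
  refine ⟨?_, ?_, ?_⟩
  · have := (integrableOn_rpow_mul_exp_neg_mul_rpow (p := κ) (s := 0) (b := δ) (by norm_num) hκ hδ).const_mul (Real.exp C)
    have := (exp_subst_int _).1 this
    refine this.congr ?_
    filter_upwards with ρ
    rw [Real.rpow_zero, one_mul, ← Real.exp_mul, ← Real.exp_add, smul_eq_mul, mul_comm ρ κ]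
    ring_nf
  · have h1 : Filter.Tendsto (fun u : ℝ => C + u * (1 / κ) * 1 - δ * Real.exp u) Filter.atTop Filter.atBot := by
      have h0 : Filter.Tendsto (fun u : ℝ => Real.exp u / u ^ 1) Filter.atTop Filter.atTop :=
        Real.tendsto_exp_div_pow_atTop 1
      have h2 : Filter.Tendsto (fun u : ℝ => u * (1 / κ - δ * (Real.exp u / u ^ 1))) Filter.atTop Filter.atBot := by
        apply Filter.Tendsto.atTop_mul_atBot₀ Filter.tendsto_id
        apply Filter.tendsto_atBot_add_const_left
        exact Filter.tendsto_neg_atTop_atBot.comp (h0.const_mul_atTop hδ)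
      refine (Filter.tendsto_atBot_add_const_left _ C h2).congr' ?_
      filter_upwards [Filter.eventually_gt_atTop 0] with u hu
      field_simp
      ring
    have h3 := Real.tendsto_exp_atBot.comp (h1.comp (Filter.tendsto_id.const_mul_atTop hκ))
    refine h3.congr fun ρ => ?_
    simp only [Function.comp, id]
    rw [← Real.exp_add]
    congr 1
    field_simp
    ring
  · have : Filter.Tendsto (fun ρ : ℝ => Real.exp C * Real.exp ρ) Filter.atBot (nhds 0) := by
      simpa using Real.tendsto_exp_atBot.const_mul (Real.exp C)
    refine squeeze_zero (fun ρ => by positivity) (fun ρ => ?_) this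
    have : 0 < δ * Real.exp (κ * ρ) := by positivity
    gcongr
    linarith

lemma vC_exp {b α s : ℝ} (hα : 1 < α) (ω : ℂ) (h1 : -π < ω.im) (h2 : ω.im ≤ π) :
    vC b α s (Complex.exp ω) =
      WW (α - 1) (b * (α - 1)) (1 / (α * b)) s ω ^ ((-(1 / (α - 1)) : ℝ) : ℂ) := by
  unfold vC WW
  have hne : (α : ℂ) - 1 ≠ 0 := by
    have : α - 1 ≠ 0 := by linarith
    exact_mod_cast this
  have hne' : 1 - (α : ℂ) ≠ 0 := by
    intro h; apply hne; linear_combination -h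
  congr 1
  · rw [Complex.cpow_def_of_ne_zero (Complex.exp_ne_zero _), Complex.log_exp h1 h2]
    have : ω * (1 - (α : ℂ)) = -((α - 1 : ℝ) : ℂ) * ω := by push_cast; ring
    rw [this]
    push_cast
    ring
  · push_cast
    field_simp
    ring

noncomputable def GG (a b α t x : ℝ) (z : ℂ) : ℂ :=
  Complex.exp ((x : ℂ) * z) * Complex.exp (-(a : ℂ) * ∫ s in (0:ℝ)..t, vC b α s z)

lemma GG_exp {a b α t x : ℝ} (hα : 1 < α) (ω : ℂ) (h1 : -π < ω.im) (h2 : ω.im ≤ π) :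
    GG a b α t x (Complex.exp ω) = HH a x (α - 1) (b * (α - 1)) (1 / (α * b)) t ω := by
  unfold GG HH VV
  simp only [vC_exp hα ω h1 h2]

open ComplexConjugate in
lemma HH_conj {a x g k c t : ℝ} (hg : 0 < g) (hg1 : g < 1) (hk : 0 < k) (hc : 0 < c) (ht : 0 < t) {ω : ℂ}
    (h : |ω.im| ≤ π) : HH a x g k c t (conj ω) = conj (HH a x g k c t ω) := by
  have hpi := Real.pi_pos
  have hab := abs_le.1 h
  have hV : VV g k c t (conj ω) = conj (VV g k c t ω) := by
    unfold VV
    rw [← intervalIntegral.intervalIntegral_conj]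
    apply intervalIntegral.integral_congr
    intro s hs
    rw [Set.uIcc_of_le ht.le] at hs
    have hsl := WW_slit (c := c) hg hk hc hs.1 (ω := ω) (by nlinarith) (by nlinarith)
    have : WW g k c s (conj ω) = conj (WW g k c s ω) := by
      unfold WW
      rw [map_add, map_mul, ← Complex.exp_conj, map_mul, map_neg, Complex.conj_ofReal, Complex.conj_ofReal,
        Complex.conj_ofReal]
    simp only
    rw [this, Complex.conj_cpow _ _ (Complex.slitPlane_arg_ne_pi hsl), Complex.conj_ofReal]
  unfold HH
  rw [hV, map_mul, ← Complex.exp_conj, ← Complex.exp_conj, map_mul, map_mul, map_neg, ← Complex.exp_conj,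
    Complex.conj_ofReal, Complex.conj_ofReal]

open ComplexConjugate in
theorem stmt_12 (a b α : ℝ) (ha : 0 < a) (hb : 0 < b) (hα : 1 < α) (hα2 : α < 2) :
    ∀ t x : ℝ, 0 < t → 0 < x →
      fDen a b α t x =
        (((1 / Real.pi) * ∫ z in Set.Ioi (0:ℝ),
            Real.exp (-x * z) *
              (-(Complex.exp (-(a : ℂ) * ∫ s in (0:ℝ)..t, vC b α s (-(z : ℂ)))).im) : ℝ) : ℂ) := by
  intro t x ht hx
  have hpi := Real.pi_pos
  have hg : 0 < α - 1 := by linarith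
  have hg1 : α - 1 < 1 := by linarith
  have hk : 0 < b * (α - 1) := by positivity
  have hc : 0 < 1 / (α * b) := by positivity
  obtain ⟨C, δ, hδ, hB⟩ := HH_bound (a := a) (x := x) ha hx hg hg1 hk hc ht
  obtain ⟨P1, P2, P3⟩ := Psi_props (C := C) (κ := 1 - (α - 1)) hδ (by linarith)
  set H := HH a x (α - 1) (b * (α - 1)) (1 / (α * b)) t with hH
  obtain ⟨S1, S2, S3⟩ := strip_shift (F := fun ω => H ω * Complex.exp ω) (y₁ := π / 2) (y₂ := π)
    (by linarith)
    (fun ω h1 h2 => by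
      have : DifferentiableAt ℂ H ω := HH_diff hg hg1 hk hc ht (abs_le.2 ⟨by linarith, h2⟩)
      fun_prop)
    (fun ω h1 h2 => by
      rw [norm_mul, Complex.norm_exp]
      exact mul_le_mul_of_nonneg_right (hB ω h1 h2) (Real.exp_pos _).le)
    P1 P2 P3
  have e1 : ∀ ρ : ℝ, Complex.exp (ρ + (π / 2 : ℝ) * Complex.I) = Complex.I * (Real.exp ρ : ℂ) := by
    intro ρ
    rw [Complex.exp_add]; push_cast; rw [Complex.exp_pi_div_two_mul_I]; ring
  have e2 : ∀ ρ : ℝ, Complex.exp (ρ + π * Complex.I) = -(Real.exp ρ : ℂ) := by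
    intro ρ
    rw [Complex.exp_add, Complex.exp_pi_mul_I]; push_cast; ring
  have e3 : ∀ ρ : ℝ, Complex.exp (conj (ρ + (π / 2 : ℝ) * Complex.I)) = -Complex.I * (Real.exp ρ : ℂ) := by
    intro ρ
    rw [Complex.exp_conj, e1, map_mul, Complex.conj_I, Complex.conj_ofReal]
  have g1 : ∀ ρ : ℝ, GG a b α t x (Complex.I * (Real.exp ρ : ℂ)) = H (ρ + (π / 2 : ℝ) * Complex.I) := by
    intro ρ
    rw [← e1]
    exact GG_exp hα _ (by simp; linarith) (by simp; linarith)
  have g2 : ∀ ρ : ℝ, GG a b α t x (-(Real.exp ρ : ℂ)) = H (ρ + π * Complex.I) := by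
    intro ρ
    rw [← e2]
    exact GG_exp hα _ (by simp; linarith) (by simp)
  have g3 : ∀ ρ : ℝ, GG a b α t x (-Complex.I * (Real.exp ρ : ℂ)) = conj (H (ρ + (π / 2 : ℝ) * Complex.I)) := by
    intro ρ
    have him : (conj (ρ + (π / 2 : ℝ) * Complex.I) : ℂ).im = -(π / 2) := by
      rw [Complex.conj_im, Complex.add_im, Complex.ofReal_im, Complex.im_ofReal_mul, Complex.I_im]
      ring
    rw [← e3, GG_exp hα _ (by rw [him]; linarith) (by rw [him]; linarith)]
    exact HH_conj hg hg1 hk hc ht (by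
      simp only [Complex.add_im, Complex.ofReal_im, Complex.im_ofReal_mul, Complex.I_im]
      rw [abs_of_pos (by linarith)]; linarith)
  have cj : ∀ η : ℝ, 0 < η → GG a b α t x (-Complex.I * (η : ℂ)) = conj (GG a b α t x (Complex.I * (η : ℂ))) := by
    intro η hη
    rw [← Real.exp_log hη, g1, g3]
  -- rewrite the shift
  set J := ∫ η in Set.Ioi (0:ℝ), GG a b α t x (Complex.I * (η : ℂ)) with hJ
  set K := ∫ ζ in Set.Ioi (0:ℝ), GG a b α t x (-(ζ : ℂ)) with hK
  have iJ : IntegrableOn (fun η : ℝ => GG a b α t x (Complex.I * (η : ℂ))) (Set.Ioi 0) := by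
    rw [exp_subst_int]
    refine (S1.const_mul (-Complex.I)).congr ?_
    filter_upwards with ρ
    rw [g1, e1, Complex.real_smul]
    linear_combination -(H (ρ + (π / 2 : ℝ) * Complex.I)) * (Real.exp ρ : ℂ) * Complex.I_mul_I
  have iK : IntegrableOn (fun ζ : ℝ => GG a b α t x (-(ζ : ℂ))) (Set.Ioi 0) := by
    rw [exp_subst_int]
    refine (S2.const_mul (-1)).congr ?_
    filter_upwards with ρ
    rw [g2, e2, Complex.real_smul]
    ring
  have hJK : Complex.I * J = - K := by
    rw [hJ, hK, exp_subst, exp_subst]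
    simp only [g1, g2]
    rw [← integral_const_mul, ← integral_neg]
    simp only [e1, e2] at S3
    refine Eq.trans ?_ (S3.trans ?_)
    · congr 1; ext ρ; ring
    · congr 1; ext ρ; ring
  have hJre : J.re = -K.im := by
    have := congrArg Complex.im hJK
    simpa using this
  -- the left side
  have iP : IntegrableOn (fun ξ : ℝ => GG a b α t x (-Complex.I * (ξ : ℂ))) (Set.Ioi 0) := by
    have : IntegrableOn (fun η : ℝ => conj (GG a b α t x (Complex.I * (η : ℂ)))) (Set.Ioi 0) :=
      Complex.conjLIE.toContinuousLinearEquiv.toContinuousLinearMap.integrable_comp iJ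
    refine this.congr_fun ?_ measurableSet_Ioi
    intro η hη
    exact (cj η hη).symm
  have iN : IntegrableOn (fun ξ : ℝ => GG a b α t x (-Complex.I * (ξ : ℂ))) (Set.Iic 0) := by
    have := (Measure.measurePreserving_neg (volume : Measure ℝ)).integrableOn_comp_preimage
      (MeasurableEquiv.neg ℝ).measurableEmbedding
      (f := fun ξ : ℝ => GG a b α t x (-Complex.I * (ξ : ℂ))) (s := Set.Iic 0)
    rw [← this]
    simp only [Set.neg_preimage, Set.neg_Iic, neg_zero]
    rw [integrableOn_Ici_iff_integrableOn_Ioi]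
    refine iJ.congr_fun ?_ measurableSet_Ioi
    intro η _
    simp
  have hL : ∫ ξ : ℝ, GG a b α t x (-Complex.I * (ξ : ℂ)) = 2 * (J.re : ℂ) := by
    rw [← intervalIntegral.integral_Iic_add_Ioi iN iP]
    have a1 : ∫ ξ in Set.Iic (0:ℝ), GG a b α t x (-Complex.I * (ξ : ℂ)) = J := by
      have := integral_comp_neg_Ioi 0 (fun ξ : ℝ => GG a b α t x (-Complex.I * (ξ : ℂ)))
      rw [neg_zero] at this
      rw [← this, hJ]
      simp
    have a2 : ∫ ξ in Set.Ioi (0:ℝ), GG a b α t x (-Complex.I * (ξ : ℂ)) = conj J := by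
      rw [hJ, ← integral_conj]
      exact setIntegral_congr_fun measurableSet_Ioi (fun η hη => cj η hη)
    rw [a1, a2, Complex.add_conj]
    push_cast; ring
  have hf : fDen a b α t x = ((1 / (2 * Real.pi) : ℝ) : ℂ) * ∫ ξ : ℝ, GG a b α t x (-Complex.I * (ξ : ℂ)) := by
    unfold fDen GG
    congr 2
    ext ξ
    congr 2
    ring
  have hR : ∫ z in Set.Ioi (0:ℝ), Real.exp (-x * z) *
              (-(Complex.exp (-(a : ℂ) * ∫ s in (0:ℝ)..t, vC b α s (-(z : ℂ)))).im) = - K.im := by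
    have : K.im = ∫ ζ in Set.Ioi (0:ℝ), (GG a b α t x (-(ζ : ℂ))).im :=
      (Complex.imCLM.integral_comp_comm iK).symm
    rw [this, ← integral_neg]
    congr 1
    ext z
    unfold GG
    have : (x : ℂ) * -(z : ℂ) = ((-x * z : ℝ) : ℂ) := by push_cast; ring
    rw [this, ← Complex.ofReal_exp, Complex.im_ofReal_mul]
    ring
  rw [hf, hL, hR, hJre]
  push_cast
  field_simp
end

section
/- Let a>0, b>0 and α∈(1,2), and fix t>0. Then the function F(w) := (1/π) ∫₀^{∞} e^{−wz} · ( −Im( exp( −a ∫₀^t v_s(−z) ds ) ) ) dz is well-defined and holomorphic on the open right half-plane { w ∈ ℂ : Re(w) > 0 }, and F(x) = f(t,x) for every real x > 0. In particular, the map x ↦ f(t,x) on (0,∞) extends to a holomorphic function on the open right half-plane. -/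
open Real MeasureTheory

/-- The holomorphic extension candidate
`F(w) = (1/π) ∫₀^∞ e^{-wz} (−Im exp(−a ∫₀ᵗ v_s(−z) ds)) dz`. -/
noncomputable def Fext (a b α t : ℝ) (w : ℂ) : ℂ :=
  ((1 / Real.pi : ℝ) : ℂ) *
    ∫ z in Set.Ioi (0:ℝ), Complex.exp (-w * (z : ℂ)) *
      (((-(Complex.exp (-(a : ℂ) * ∫ s in (0:ℝ)..t, vC b α s (-(z : ℂ)))).im : ℝ)) : ℂ)

namespace Q13

/-- base of the power, in logarithmic coordinates -/
noncomputable def W (b δ c s : ℝ) (ζ : ℂ) : ℂ :=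
  ((c * (Real.exp (b * δ * s) - 1) : ℝ) : ℂ) +
    ((Real.exp (b * δ * s) : ℝ) : ℂ) * Complex.exp (-(δ : ℂ) * ζ)

noncomputable def V (b δ c s : ℝ) (ζ : ℂ) : ℂ := (W b δ c s ζ) ^ ((-(1 / δ) : ℝ) : ℂ)

noncomputable def P (b δ c t : ℝ) (ζ : ℂ) : ℂ := ∫ s in (0:ℝ)..t, V b δ c s ζ

/-- the model point -/
noncomputable def w0 (k e φ : ℝ) : ℂ := (k : ℂ) + (e : ℂ) * Complex.exp (-(φ : ℂ) * Complex.I)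

lemma w0_re (k e φ : ℝ) : (w0 k e φ).re = k + e * Real.cos φ := by
  simp [w0, Complex.exp_re]

lemma w0_im (k e φ : ℝ) : (w0 k e φ).im = - e * Real.sin φ := by
  simp [w0, Complex.exp_im]

lemma W_eq (b δ c s : ℝ) (ζ : ℂ) : W b δ c s ζ =
    w0 (c * (Real.exp (b * δ * s) - 1)) (Real.exp (b * δ * s) * Real.exp (-δ * ζ.re)) (δ * ζ.im) := by
  have : -(δ : ℂ) * ζ = ((-δ * ζ.re : ℝ) : ℂ) + (-((δ * ζ.im : ℝ) : ℂ)) * Complex.I := by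
    apply Complex.ext <;> simp
  rw [W, w0, this, Complex.exp_add]
  push_cast
  ring

lemma w0_slit {k e φ : ℝ} (hk : 0 ≤ k) (he : 0 < e) (h1 : |φ| < π) :
    w0 k e φ ∈ Complex.slitPlane := by
  rw [Complex.mem_slitPlane_iff, w0_re, w0_im]
  obtain ⟨h2, h3⟩ := abs_lt.1 h1
  rcases lt_trichotomy φ 0 with h | h | h
  · right
    have := Real.sin_neg_of_neg_of_neg_pi_lt h h2
    nlinarith [mul_neg_of_pos_of_neg he this]
  · left; subst h; simp; linarith
  · right
    have := Real.sin_pos_of_pos_of_lt_pi h h3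
    nlinarith [mul_pos he this]

lemma w0_norm_le {k e φ : ℝ} (hk : 0 ≤ k) (he : 0 < e) : ‖w0 k e φ‖ ≤ k + e := by
  refine (norm_add_le _ _).trans ?_
  have : ‖Complex.exp (-(φ : ℂ) * Complex.I)‖ = 1 := by
    simp [Complex.norm_exp]
  rw [norm_mul, this]
  simp [abs_of_nonneg hk, abs_of_pos he]

lemma w0_rot (k e φ β : ℝ) :
    (Complex.exp ((β : ℂ) * Complex.I) * w0 k e φ).re = k * Real.cos β + e * Real.cos (φ - β) := by
  have : Complex.exp ((β : ℂ) * Complex.I) * w0 k e φ =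
     (k : ℂ) * Complex.exp ((β : ℂ) * Complex.I) + (e : ℂ) * Complex.exp (((β - φ : ℝ) : ℂ) * Complex.I) := by
    rw [w0]
    have : ((β - φ : ℝ) : ℂ) * Complex.I = (β : ℂ) * Complex.I + (-(φ : ℂ) * Complex.I) := by
      push_cast; ring
    rw [this, Complex.exp_add]; ring
  rw [this, ← Real.cos_neg (φ - β), neg_sub, Complex.add_re, Complex.re_ofReal_mul,
    Complex.re_ofReal_mul, Complex.exp_ofReal_mul_I_re, Complex.exp_ofReal_mul_I_re]

lemma w0_norm_ge {k e φ : ℝ} : Real.cos (φ / 2) * (k + e) ≤ ‖w0 k e φ‖ := by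
  have h := Complex.re_le_norm (Complex.exp (((φ/2 : ℝ) : ℂ) * Complex.I) * w0 k e φ)
  rw [w0_rot, norm_mul, Complex.norm_exp_ofReal_mul_I] at h
  have : φ - φ / 2 = φ / 2 := by ring
  rw [this] at h
  linarith

lemma w0_sin {k e φ : ℝ} : ‖w0 k e φ‖ * Real.sin ((w0 k e φ).arg + φ) = k * Real.sin φ := by
  rw [Real.sin_add, mul_add, ← mul_assoc, ← mul_assoc, Complex.norm_mul_sin_arg,
    Complex.norm_mul_cos_arg, w0_re, w0_im]
  ring

lemma w0_arg {k e φ : ℝ} (hk : 0 ≤ k) (he : 0 < e) (h0 : 0 < φ) (h1 : φ < π) :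
    (w0 k e φ).arg < 0 ∧ -φ ≤ (w0 k e φ).arg := by
  have hs := Real.sin_pos_of_pos_of_lt_pi h0 h1
  have hneg : (w0 k e φ).arg < 0 := by
    rw [Complex.arg_neg_iff, w0_im]; nlinarith [mul_pos he hs]
  refine ⟨hneg, ?_⟩
  by_contra! h
  have h2 := Complex.neg_pi_lt_arg (w0 k e φ)
  have h3 : Real.sin ((w0 k e φ).arg + φ) < 0 :=
    Real.sin_neg_of_neg_of_neg_pi_lt (by linarith) (by linarith)
  have h4 := @w0_sin k e φ
  have h5 : 0 < ‖w0 k e φ‖ := by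
    rw [norm_pos_iff]
    exact Complex.slitPlane_ne_zero (w0_slit hk he (by rw [abs_of_pos h0]; exact h1))
  nlinarith [mul_neg_of_pos_of_neg h5 h3, mul_nonneg hk hs.le]

lemma w0_arg2 {k e φ l m : ℝ} (he : 0 < e) (h0 : 0 < φ) (h1 : φ < π) (hl : 0 < l)
    (hk : l * e ≤ k) (hm : m ≤ Real.sin φ) (hm0 : 0 < m) :
    -φ + l / (1 + l) * m ≤ (w0 k e φ).arg := by
  have hk0 : 0 < k := lt_of_lt_of_le (by positivity) hk
  obtain ⟨h2, h3⟩ := w0_arg hk0.le he h0 h1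
  have h4 := @w0_sin k e φ
  have h5 : 0 < ‖w0 k e φ‖ := by
    rw [norm_pos_iff]
    exact Complex.slitPlane_ne_zero (w0_slit hk0.le he (by rw [abs_of_pos h0]; exact h1))
  have h6 := @w0_norm_le k e φ hk0.le he
  have h7 : Real.sin ((w0 k e φ).arg + φ) ≤ (w0 k e φ).arg + φ := Real.sin_le (by linarith)
  have h8 : 0 ≤ Real.sin ((w0 k e φ).arg + φ) :=
    Real.sin_nonneg_of_nonneg_of_le_pi (by linarith) (by linarith)
  have h9 : l / (1 + l) * m ≤ Real.sin ((w0 k e φ).arg + φ) := by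
    have h10 : k * m ≤ (k + e) * Real.sin ((w0 k e φ).arg + φ) := by
      nlinarith [mul_le_mul_of_nonneg_right h6 h8, mul_le_mul_of_nonneg_left hm hk0.le]
    have h11 : k / (k + e) * m ≤ Real.sin ((w0 k e φ).arg + φ) := by
      rw [div_mul_eq_mul_div, div_le_iff₀ (by positivity)]; linarith
    refine le_trans ?_ h11
    gcongr ?_ * m
    rw [div_le_div_iff₀ (by positivity) (by positivity)]
    nlinarith
  linarith

/-- facts about the negative real power -/
lemma cpow_facts {w : ℂ} (hw : w ≠ 0) (q : ℝ) :
    ‖w ^ ((-q : ℝ) : ℂ)‖ = ‖w‖ ^ (-q) ∧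
    (w ^ ((-q : ℝ) : ℂ)).re = ‖w‖ ^ (-q) * Real.cos (-w.arg * q) := by
  have h : w ^ ((-q : ℝ) : ℂ) = ((‖w‖ ^ (-q) : ℝ) : ℂ) * Complex.exp (((-w.arg * q : ℝ) : ℂ) * Complex.I) := by
    rw [Complex.cpow_def_of_ne_zero hw, Complex.log, Real.rpow_def_of_pos (norm_pos_iff.2 hw),
      Complex.ofReal_exp, ← Complex.exp_add]
    push_cast; ring_nf
  rw [h]
  constructor
  · rw [norm_mul, Complex.norm_exp_ofReal_mul_I, Complex.norm_real, mul_one, Real.norm_eq_abs,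
      abs_of_nonneg (by positivity)]
  · rw [Complex.re_ofReal_mul, Complex.exp_ofReal_mul_I_re]

lemma W_slit {b δ c s : ℝ} {ζ : ℂ} (hb : 0 < b) (hδ : 0 < δ) (hc : 0 < c) (hs : 0 ≤ s)
    (h : |δ * ζ.im| < π) : W b δ c s ζ ∈ Complex.slitPlane := by
  rw [W_eq]
  refine w0_slit ?_ (by positivity) h
  have : 1 ≤ Real.exp (b * δ * s) := Real.one_le_exp (by positivity)
  exact mul_nonneg hc.le (by linarith)

lemma W_cont (b δ c : ℝ) : Continuous (fun p : ℝ × ℂ => W b δ c p.1 p.2) := by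
  unfold W; fun_prop

/-- the open strip -/
def S (δ : ℝ) : Set ℂ := {ζ | |δ * ζ.im| < π}

lemma S_open (δ : ℝ) : IsOpen (S δ) :=
  isOpen_lt (by fun_prop) continuous_const

lemma Wpow_cont {b δ c : ℝ} (hb : 0 < b) (hδ : 0 < δ) (hc : 0 < c) (q : ℂ) :
    ContinuousOn (fun p : ℝ × ℂ => (W b δ c p.1 p.2) ^ q) (Set.Ici 0 ×ˢ S δ) := by
  refine (W_cont b δ c).continuousOn.cpow continuousOn_const ?_
  rintro ⟨s, ζ⟩ ⟨h1, h2⟩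
  exact W_slit hb hδ hc h1 h2

lemma V_cont_s {b δ c : ℝ} (hb : 0 < b) (hδ : 0 < δ) (hc : 0 < c) (q : ℂ) {ζ : ℂ} (hζ : ζ ∈ S δ) :
    ContinuousOn (fun s : ℝ => (W b δ c s ζ) ^ q) (Set.Ici 0) :=
  (Wpow_cont hb hδ hc q).comp (f := fun s : ℝ => (s, ζ)) (by fun_prop) (fun s hs => ⟨hs, hζ⟩)

lemma V_intble {b δ c t : ℝ} (hb : 0 < b) (hδ : 0 < δ) (hc : 0 < c) (ht : 0 ≤ t) {ζ : ℂ} (hζ : ζ ∈ S δ) :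
    IntervalIntegrable (fun s => V b δ c s ζ) volume 0 t := by
  apply ContinuousOn.intervalIntegrable
  rw [Set.uIcc_of_le ht]
  exact (V_cont_s hb hδ hc _ hζ).mono Set.Icc_subset_Ici_self

lemma P_diff {b δ c t : ℝ} (hb : 0 < b) (hδ : 0 < δ) (hc : 0 < c) (ht : 0 ≤ t) {ζ : ℂ}
    (hζ : ζ ∈ S δ) : DifferentiableAt ℂ (P b δ c t) ζ := by
  obtain ⟨ε, hε, hball⟩ := Metric.nhds_basis_closedBall.mem_iff.1 ((S_open δ).mem_nhds hζ)
  set q : ℂ := ((-(1 / δ) : ℝ) : ℂ) with hq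
  let V' : ℂ → ℝ → ℂ := fun ζ s =>
    q * (W b δ c s ζ) ^ (q - 1) * (((Real.exp (b * δ * s) : ℝ) : ℂ) * (Complex.exp (-(δ : ℂ) * ζ) * (-(δ : ℂ))))
  have hc' : ContinuousOn (fun p : ℝ × ℂ => V' p.2 p.1) (Set.Ici 0 ×ˢ S δ) := by
    refine (continuousOn_const.mul (Wpow_cont hb hδ hc (q - 1))).mul (Continuous.continuousOn ?_)
    fun_prop
  have hcomp : IsCompact (Set.Icc 0 t ×ˢ Metric.closedBall ζ ε) :=
    isCompact_Icc.prod (isCompact_closedBall ζ ε)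
  obtain ⟨B, hB⟩ := hcomp.exists_bound_of_continuousOn
    (hc'.mono (Set.prod_mono Set.Icc_subset_Ici_self hball))
  have huI : Set.uIoc 0 t = Set.Ioc 0 t := Set.uIoc_of_le ht
  refine (intervalIntegral.hasDerivAt_integral_of_dominated_loc_of_deriv_le (F := fun ζ s => V b δ c s ζ)
    (F' := V') (bound := fun _ => B) (s := Metric.closedBall ζ ε) (Metric.closedBall_mem_nhds _ hε)
    ?_ (V_intble hb hδ hc ht hζ) ?_ ?_ (by simp) ?_).2.differentiableAt
  · filter_upwards [(S_open δ).mem_nhds hζ] with z hz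
    have := (V_intble hb hδ hc ht hz).1
    rw [huI]; exact this.aestronglyMeasurable
  · rw [huI]
    refine ContinuousOn.aestronglyMeasurable ?_ measurableSet_Ioc
    exact hc'.comp (f := fun s : ℝ => (s, ζ)) (by fun_prop) (fun s hs => ⟨hs.1.le, hζ⟩)
  · refine Filter.Eventually.of_forall fun s hs z hz => ?_
    rw [huI] at hs
    exact hB (s, z) ⟨⟨hs.1.le, hs.2⟩, hz⟩
  · refine Filter.Eventually.of_forall fun s hs z hz => ?_
    rw [huI] at hs
    have hW : HasDerivAt (fun z => W b δ c s z)
        (((Real.exp (b * δ * s) : ℝ) : ℂ) * (Complex.exp (-(δ : ℂ) * z) * (-(δ : ℂ)))) z := by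
      unfold W
      refine HasDerivAt.const_add _ (HasDerivAt.const_mul _ (HasDerivAt.cexp ?_))
      have h := (hasDerivAt_id z).const_mul (-(δ : ℂ))
      rw [mul_one] at h
      exact h
    exact hW.cpow_const (c := q) (W_slit hb hδ hc hs.1.le (hball hz))

lemma strip_mem {δ : ℝ} {ζ : ℂ} (hδ : 0 < δ) (hδ1 : δ < 1) (h1 : π / 2 ≤ ζ.im) (h2 : ζ.im ≤ π) :
    0 < δ * ζ.im ∧ δ * ζ.im < π ∧ ζ ∈ S δ := by
  have hp := Real.pi_pos
  have h3 : 0 < δ * ζ.im := mul_pos hδ (by linarith)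
  have h4 : δ * ζ.im < π := by nlinarith
  exact ⟨h3, h4, by rw [S, Set.mem_ofPred_eq, abs_of_pos h3]; exact h4⟩

lemma V_facts {b δ c s : ℝ} {ζ : ℂ} (hb : 0 < b) (hδ : 0 < δ) (hc : 0 < c) (hs : 0 ≤ s)
    (h : ζ ∈ S δ) : ‖V b δ c s ζ‖ = ‖W b δ c s ζ‖ ^ (-(1 / δ)) ∧
      (V b δ c s ζ).re = ‖V b δ c s ζ‖ * Real.cos (-(W b δ c s ζ).arg * (1 / δ)) := by
  have h1 := cpow_facts (Complex.slitPlane_ne_zero (W_slit hb hδ hc hs h)) (1 / δ)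
  refine ⟨h1.1, ?_⟩
  unfold V
  rw [h1.2, h1.1]

lemma k_ge {b δ c s : ℝ} (hb : 0 < b) (hδ : 0 < δ) (hc : 0 < c) :
    c * b * δ * s ≤ c * (Real.exp (b * δ * s) - 1) := by
  have := Real.add_one_le_exp (b * δ * s)
  nlinarith

lemma exp_rpow_aux {δ u : ℝ} (hδ : 0 < δ) : (Real.exp (-δ * u)) ^ (-(1 / δ)) = Real.exp u := by
  rw [← Real.exp_mul]; congr 1; field_simp

lemma W_ge {b δ c s : ℝ} {ζ : ℂ} (hb : 0 < b) (hδ : 0 < δ) (hδ1 : δ < 1) (hc : 0 < c) (hs : 0 ≤ s)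
    (h1 : π / 2 ≤ ζ.im) (h2 : ζ.im ≤ π) :
    0 < Real.cos (δ * π / 2) ∧
    Real.cos (δ * π / 2) * (c * b * δ * s + Real.exp (-δ * ζ.re)) ≤ ‖W b δ c s ζ‖ := by
  have hp := Real.pi_pos
  obtain ⟨h3, h4, h5⟩ := strip_mem hδ hδ1 h1 h2
  have hm : 0 < Real.cos (δ * π / 2) := Real.cos_pos_of_mem_Ioo ⟨by nlinarith, by nlinarith⟩
  refine ⟨hm, ?_⟩
  rw [W_eq]
  refine le_trans ?_ w0_norm_ge
  have hk := k_ge (s := s) hb hδ hc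
  have hE : 1 ≤ Real.exp (b * δ * s) := Real.one_le_exp (by positivity)
  have hcos : Real.cos (δ * π / 2) ≤ Real.cos (δ * ζ.im / 2) :=
    Real.cos_le_cos_of_nonneg_of_le_pi (by positivity) (by nlinarith) (by nlinarith)
  have he := Real.exp_pos (-δ * ζ.re)
  have h6 : c * b * δ * s + Real.exp (-δ * ζ.re) ≤
      c * (Real.exp (b * δ * s) - 1) + Real.exp (b * δ * s) * Real.exp (-δ * ζ.re) := by nlinarith
  exact mul_le_mul hcos h6 (by positivity) (by linarith)

lemma exists_M {b δ c : ℝ} (hb : 0 < b) (hδ : 0 < δ) (hδ1 : δ < 1) (hc : 0 < c) :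
    ∃ M > 0, ∀ s : ℝ, 0 ≤ s → ∀ ζ : ℂ, π / 2 ≤ ζ.im → ζ.im ≤ π →
      ‖V b δ c s ζ‖ ≤ M * Real.exp ζ.re := by
  have hp := Real.pi_pos
  have hm : 0 < Real.cos (δ * π / 2) := Real.cos_pos_of_mem_Ioo ⟨by nlinarith, by nlinarith⟩
  refine ⟨Real.cos (δ * π / 2) ^ (-(1 / δ)), by positivity, fun s hs ζ h1 h2 => ?_⟩
  rw [(V_facts hb hδ hc hs (strip_mem hδ hδ1 h1 h2).2.2).1, ← exp_rpow_aux (u := ζ.re) hδ,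
    ← Real.mul_rpow hm.le (Real.exp_pos _).le]
  refine Real.rpow_le_rpow_of_nonpos (by positivity) ?_ (by simp; positivity)
  refine le_trans ?_ (W_ge hb hδ hδ1 hc hs h1 h2).2
  gcongr
  have : 0 ≤ c * b * δ * s := by positivity
  linarith

lemma exists_N {b δ c ε : ℝ} (hb : 0 < b) (hδ : 0 < δ) (hδ1 : δ < 1) (hc : 0 < c) (hε : 0 < ε) :
    ∃ N > 0, ∀ s : ℝ, ε ≤ s → ∀ ζ : ℂ, π / 2 ≤ ζ.im → ζ.im ≤ π →
      ‖V b δ c s ζ‖ ≤ N := by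
  have hp := Real.pi_pos
  have hm : 0 < Real.cos (δ * π / 2) := Real.cos_pos_of_mem_Ioo ⟨by nlinarith, by nlinarith⟩
  refine ⟨(Real.cos (δ * π / 2) * (c * b * δ * ε)) ^ (-(1 / δ)), by positivity, fun s hs ζ h1 h2 => ?_⟩
  have hs0 : 0 ≤ s := by linarith
  rw [(V_facts hb hδ hc hs0 (strip_mem hδ hδ1 h1 h2).2.2).1]
  refine Real.rpow_le_rpow_of_nonpos (by positivity) ?_ (by simp; positivity)
  refine le_trans ?_ (W_ge hb hδ hδ1 hc hs0 h1 h2).2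
  gcongr
  have h3 : c * b * δ * ε ≤ c * b * δ * s := by gcongr
  have := Real.exp_pos (-δ * ζ.re)
  linarith

lemma V_re1 {b δ c s : ℝ} {ζ : ℂ} (hb : 0 < b) (hδ : 0 < δ) (hδ1 : δ < 1) (hc : 0 < c) (hs : 0 ≤ s)
    (h1 : π / 2 ≤ ζ.im) (h2 : ζ.im ≤ π) :
    Real.cos ζ.im * ‖V b δ c s ζ‖ ≤ (V b δ c s ζ).re := by
  obtain ⟨h3, h4, h5⟩ := strip_mem hδ hδ1 h1 h2
  rw [(V_facts hb hδ hc hs h5).2, mul_comm]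
  gcongr
  have hk : 0 ≤ c * (Real.exp (b * δ * s) - 1) := le_trans (by positivity) (k_ge hb hδ hc)
  obtain ⟨ha, hb'⟩ := w0_arg (e := Real.exp (b * δ * s) * Real.exp (-δ * ζ.re)) hk (by positivity) h3 h4
  rw [← W_eq] at ha hb'
  refine Real.cos_le_cos_of_nonneg_of_le_pi ?_ h2 ?_
  · have : 0 < -(W b δ c s ζ).arg := by linarith
    positivity
  · rw [mul_one_div, div_le_iff₀ hδ]; linarith

lemma exists_c1 {b δ c t : ℝ} (hb : 0 < b) (hδ : 0 < δ) (hδ1 : δ < 1) (hc : 0 < c) (ht : 0 < t) :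
    ∃ c1 > 0, ∀ ζ : ℂ, π / 2 ≤ ζ.im → ζ.im ≤ π → ∀ s : ℝ, Real.exp (-δ * ζ.re) ≤ s →
      s ≤ 2 * Real.exp (-δ * ζ.re) → s ≤ t →
      Real.cos ζ.im * ‖V b δ c s ζ‖ + c1 * Real.exp ζ.re ≤ (V b δ c s ζ).re := by
  have hp := Real.pi_pos
  -- lower bound for the sine
  obtain ⟨m, hm0, hm⟩ : ∃ m > 0, ∀ φ, δ * (π / 2) ≤ φ → φ ≤ δ * π → m ≤ Real.sin φ := by
    obtain ⟨y, hy, hy2⟩ := (isCompact_Icc (a := δ * (π / 2)) (b := δ * π)).exists_isMinOn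
      (Set.nonempty_Icc.2 (by nlinarith)) Real.continuous_sin.continuousOn
    refine ⟨Real.sin y, Real.sin_pos_of_pos_of_lt_pi (lt_of_lt_of_le (by positivity) hy.1) ?_,
      fun φ h1 h2 => hy2 ⟨h1, h2⟩⟩
    exact lt_of_le_of_lt hy.2 (by nlinarith)
  set Et := Real.exp (b * δ * t) with hEt
  have hEt1 : 0 < Et := Real.exp_pos _
  set l := c * b * δ / Et with hl
  have hl0 : 0 < l := by positivity
  set η := min (l / (1 + l) * m / δ) (π / 2) with hη
  have hη0 : 0 < η := lt_min (by positivity) (by positivity)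
  obtain ⟨g, hg0, hg⟩ : ∃ g > 0, ∀ θ, π / 2 ≤ θ → θ ≤ π → g ≤ Real.cos (θ - η) - Real.cos θ := by
    obtain ⟨y, hy, hy2⟩ := (isCompact_Icc (a := π / 2) (b := π)).exists_isMinOn
      (f := fun θ => Real.cos (θ - η) - Real.cos θ)
      (Set.nonempty_Icc.2 (by linarith)) (by fun_prop)
    refine ⟨_, ?_, fun φ h1 h2 => hy2 ⟨h1, h2⟩⟩
    have : Real.cos y < Real.cos (y - η) := by
      refine Real.cos_lt_cos_of_nonneg_of_le_pi ?_ hy.2 (by linarith)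
      have : η ≤ π / 2 := min_le_right _ _
      linarith [hy.1]
    linarith
  set K := (2 * (c * b * δ) * Et + Et) ^ (-(1 / δ)) with hK
  have hK0 : 0 < K := by positivity
  refine ⟨K * g, by positivity, fun ζ h1 h2 s hs1 hs2 hs3 => ?_⟩
  obtain ⟨h3, h4, h5⟩ := strip_mem hδ hδ1 h1 h2
  set ρ := Real.exp (-δ * ζ.re) with hρ
  have hρ0 : 0 < ρ := Real.exp_pos _
  have hs0 : 0 < s := by linarith
  set E := Real.exp (b * δ * s) with hE
  have hE0 : 0 < E := Real.exp_pos _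
  have hEle : E ≤ Et := Real.exp_le_exp.2 (by gcongr)
  have hk := k_ge (s := s) hb hδ hc
  rw [← hE] at hk
  have hk0 : 0 ≤ c * (E - 1) := le_trans (by positivity) hk
  have hkl : l * (E * ρ) ≤ c * (E - 1) := by
    refine le_trans ?_ hk
    have : l * E ≤ c * b * δ := by
      rw [hl, div_mul_eq_mul_div, div_le_iff₀ hEt1]; gcongr
    calc l * (E * ρ) = (l * E) * ρ := by ring
      _ ≤ c * b * δ * s := by gcongr
  have hA := (w0_arg (e := E * ρ) hk0 (by positivity) h3 h4).1
  have hA2 := w0_arg2 (e := E * ρ) (by positivity) h3 h4 hl0 hkl (hm (δ * ζ.im) (by gcongr) (by gcongr)) hm0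
  rw [← W_eq] at hA hA2
  obtain ⟨hV1, hV2⟩ := V_facts hb hδ hc hs0.le h5
  have hcos : g ≤ Real.cos (-(W b δ c s ζ).arg * (1 / δ)) - Real.cos ζ.im := by
    refine (hg ζ.im h1 h2).trans ?_
    gcongr
    refine Real.cos_le_cos_of_nonneg_of_le_pi ?_ (by linarith) ?_
    · have : 0 < -(W b δ c s ζ).arg := by linarith
      positivity
    · have h6 : -(W b δ c s ζ).arg * (1 / δ) ≤ ζ.im - l / (1 + l) * m / δ := by
        have h7 : -(W b δ c s ζ).arg ≤ δ * ζ.im - l / (1 + l) * m := by linarith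
        calc -(W b δ c s ζ).arg * (1 / δ) ≤ (δ * ζ.im - l / (1 + l) * m) * (1 / δ) := by gcongr
          _ = ζ.im - l / (1 + l) * m / δ := by field_simp
      have : η ≤ l / (1 + l) * m / δ := min_le_left _ _
      linarith
  have hVge : K * Real.exp ζ.re ≤ ‖V b δ c s ζ‖ := by
    rw [hV1, ← exp_rpow_aux (u := ζ.re) hδ, hK, ← Real.mul_rpow (by positivity) (Real.exp_pos _).le]
    refine Real.rpow_le_rpow_of_nonpos (norm_pos_iff.2 (Complex.slitPlane_ne_zero (W_slit hb hδ hc hs0.le h5))) ?_ (by simp; positivity)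
    rw [W_eq]
    refine (w0_norm_le hk0 (by positivity)).trans ?_
    have hup : E - 1 ≤ b * δ * s * E := by
      have h8 := Real.add_one_le_exp (-(b * δ * s))
      have h9 : Real.exp (-(b * δ * s)) * E = 1 := by rw [hE, ← Real.exp_add]; simp
      nlinarith
    have h10 : c * (E - 1) ≤ 2 * (c * b * δ) * Et * ρ := by
      calc c * (E - 1) ≤ c * (b * δ * s * E) := by gcongr
        _ ≤ c * (b * δ * (2 * ρ) * Et) := by gcongr
        _ = _ := by ring
    have h11 : E * ρ ≤ Et * ρ := by gcongr
    rw [← hρ, add_mul]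
    linarith
  rw [hV2]
  nlinarith [mul_le_mul hVge hcos hg0.le (norm_nonneg _)]

/-- integrand along the contour -/
noncomputable def G (a b δ c t x : ℝ) (ζ : ℂ) : ℂ :=
  Complex.exp ((x : ℂ) * Complex.exp ζ) * Complex.exp (-(a : ℂ) * P b δ c t ζ)

lemma G_norm (a b δ c t x : ℝ) (ζ : ℂ) : ‖G a b δ c t x ζ‖ =
    Real.exp (x * (Real.exp ζ.re * Real.cos ζ.im) - a * (P b δ c t ζ).re) := by
  rw [G, norm_mul, Complex.norm_exp, Complex.norm_exp, ← Real.exp_add, Complex.re_ofReal_mul,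
    Complex.exp_re, ← Complex.ofReal_neg, Complex.re_ofReal_mul]
  ring_nf

lemma P_re {b δ c t : ℝ} (hb : 0 < b) (hδ : 0 < δ) (hc : 0 < c) (ht : 0 ≤ t) {ζ : ℂ}
    (hζ : ζ ∈ S δ) : (P b δ c t ζ).re = ∫ s in Set.Ioc 0 t, (V b δ c s ζ).re := by
  rw [P, intervalIntegral.integral_of_le ht]
  have := integral_re (𝕜 := ℂ) ((V_intble hb hδ hc ht hζ).1)
  simpa using this.symm

lemma integral_ind {t p q : ℝ} (A : ℝ) (hp : 0 ≤ p) (hpq : p ≤ q) (hq : q ≤ t) :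
    IntegrableOn (Set.indicator (Set.Ioc p q) (fun _ => A)) (Set.Ioc 0 t) ∧
    ∫ s in Set.Ioc 0 t, Set.indicator (Set.Ioc p q) (fun _ => A) s = A * (q - p) := by
  constructor
  · exact (integrableOn_const (by simp)).indicator measurableSet_Ioc
  · rw [setIntegral_indicator measurableSet_Ioc,
      Set.inter_eq_self_of_subset_right (Set.Ioc_subset_Ioc hp hq)]
    simp [hpq, mul_comm]

lemma main_bound {a b δ c t x : ℝ} (ha : 0 < a) (hb : 0 < b) (hδ : 0 < δ) (hδ1 : δ < 1) (hc : 0 < c)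
    (ht : 0 < t) (hx : 0 < x) :
    ∃ C > 0, ∃ d > 0, ∀ ζ : ℂ, π / 2 ≤ ζ.im → ζ.im ≤ π →
      ‖G a b δ c t x ζ‖ ≤ C * Real.exp (-d * (Real.exp ζ.re) ^ (1 - δ)) := by
  obtain ⟨M, hM0, hM⟩ := exists_M (c := c) hb hδ hδ1 hc
  set ε := min t (x / (a * M)) with hε
  have hε0 : 0 < ε := lt_min ht (by positivity)
  have hεt : ε ≤ t := min_le_left _ _
  have hεM : a * M * ε ≤ x := by
    have : ε ≤ x / (a * M) := min_le_right _ _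
    rw [le_div_iff₀ (by positivity)] at this; linarith
  obtain ⟨N, hN0, hN⟩ := exists_N (c := c) hb hδ hδ1 hc hε0
  obtain ⟨c1, hc10, hc1⟩ := exists_c1 (c := c) hb hδ hδ1 hc ht
  set r0 := (2 / t) ^ (1 / δ) with hr0
  have hr00 : 0 < r0 := by positivity
  set d := a * c1 with hd
  refine ⟨Real.exp (a * (N * t) + a * (M * r0 * t) + d * r0 ^ (1 - δ)), Real.exp_pos _, d,
    by positivity, fun ζ h1 h2 => ?_⟩
  obtain ⟨h3, h4, h5⟩ := strip_mem hδ hδ1 h1 h2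
  rw [G_norm, ← Real.exp_add]
  apply Real.exp_le_exp.2
  set r := Real.exp ζ.re with hr
  have hr1 : 0 < r := Real.exp_pos _
  set ρ := Real.exp (-δ * ζ.re) with hρ
  have hρ0 : 0 < ρ := Real.exp_pos _
  have hrρ : r * ρ = r ^ (1 - δ) := by
    rw [hr, hρ, ← Real.exp_add, ← Real.exp_mul]; ring_nf
  have hp := Real.pi_pos
  have hcos : Real.cos ζ.im ≤ 0 := Real.cos_nonpos_of_pi_div_two_le_of_le h1 (by linarith)
  have hcos1 : -1 ≤ Real.cos ζ.im := Real.neg_one_le_cos _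
  have hNt : 0 < a * (N * t) := by positivity
  have hMt : 0 < a * (M * r0 * t) := by positivity
  have hdt : 0 < d * r0 ^ (1 - δ) := by positivity
  rcases le_or_gt (2 * ρ) t with h6 | h6
  · obtain ⟨i1, e1⟩ := integral_ind (t := t) (M * r) le_rfl hε0.le hεt
    obtain ⟨i2, e2⟩ := integral_ind (t := t) (c1 * r) hρ0.le (by linarith : ρ ≤ 2 * ρ) h6
    have i3 : IntegrableOn (fun _ : ℝ => N) (Set.Ioc 0 t) := integrableOn_const (by simp)
    have hle : Real.cos ζ.im * (M * r * (ε - 0) + N * t) + c1 * r * (2 * ρ - ρ) ≤ (P b δ c t ζ).re := by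
      rw [P_re hb hδ hc ht.le h5]
      have e3 : ∫ s in Set.Ioc 0 t, N = N * t := by simp [ht.le, mul_comm]
      have i4 : IntegrableOn (fun s => Real.cos ζ.im *
          (Set.indicator (Set.Ioc 0 ε) (fun _ => M * r) s + N)) (Set.Ioc 0 t) := (i1.add i3).const_mul _
      rw [← e1, ← e2, ← e3, ← integral_add i1 i3, ← integral_const_mul, ← integral_add i4 i2]
      refine setIntegral_mono_on (i4.add i2) ?_ measurableSet_Ioc ?_
      · exact (V_intble hb hδ hc ht.le h5).1.re
      · intro s hs
        have hV : ‖V b δ c s ζ‖ ≤ Set.indicator (Set.Ioc 0 ε) (fun _ => M * r) s + N := by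
          rcases le_or_gt s ε with h | h
          · have hmem : s ∈ Set.Ioc 0 ε := ⟨hs.1, h⟩
            rw [Set.indicator_of_mem hmem]
            have := hM s hs.1.le ζ h1 h2
            linarith
          · have := hN s h.le ζ h1 h2
            have hnm : s ∉ Set.Ioc 0 ε := fun h' => by linarith [h'.2]
            rw [Set.indicator_of_notMem hnm]
            linarith
        have hV2 : Real.cos ζ.im * ‖V b δ c s ζ‖ + Set.indicator (Set.Ioc ρ (2 * ρ)) (fun _ => c1 * r) s
            ≤ (V b δ c s ζ).re := by
          by_cases h : s ∈ Set.Ioc ρ (2 * ρ)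
          · rw [Set.indicator_of_mem h]
            exact hc1 ζ h1 h2 s h.1.le h.2 hs.2
          · rw [Set.indicator_of_notMem h]
            have := V_re1 hb hδ hδ1 hc hs.1.le h1 h2
            linarith
        have := mul_le_mul_of_nonpos_left hV hcos
        linarith
    have h7 := mul_le_mul_of_nonneg_left hle ha.le
    have h8 : a * (Real.cos ζ.im * (M * r * (ε - 0) + N * t) + c1 * r * (2 * ρ - ρ)) =
      Real.cos ζ.im * ((a * M * ε) * r) + Real.cos ζ.im * (a * (N * t)) + d * (r * ρ) := by
      rw [hd]; ring
    rw [h8, hrρ] at h7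
    have h9 : x * r * Real.cos ζ.im ≤ (a * M * ε) * r * Real.cos ζ.im := by
      apply mul_le_mul_of_nonpos_right _ hcos
      gcongr
    nlinarith
  · have hrr : r ≤ r0 := by
      rw [hr0, hr, ← exp_rpow_aux (u := ζ.re) hδ, ← hρ, Real.rpow_neg hρ0.le, ← Real.inv_rpow hρ0.le]
      apply Real.rpow_le_rpow (by positivity) _ (by positivity)
      rw [inv_eq_one_div, div_le_div_iff₀ hρ0 ht]; linarith
    have hP : ‖P b δ c t ζ‖ ≤ M * r * |t - 0| := by
      apply intervalIntegral.norm_integral_le_of_norm_le_const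
      intro s hs
      rw [Set.uIoc_of_le ht.le] at hs
      exact hM s hs.1.le ζ h1 h2
    rw [sub_zero, abs_of_pos ht] at hP
    have hP2 : -(P b δ c t ζ).re ≤ M * r0 * t := by
      have h10 := (abs_le.1 (Complex.abs_re_le_norm (P b δ c t ζ))).1
      have h11 : M * r * t ≤ M * r0 * t := by gcongr
      linarith
    have h12 := mul_le_mul_of_nonneg_left hP2 ha.le
    have h13 : r ^ (1 - δ) ≤ r0 ^ (1 - δ) := Real.rpow_le_rpow hr1.le hrr (by linarith)
    have hd0 : 0 < d := by positivity
    have h14 := mul_le_mul_of_nonneg_left h13 hd0.le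
    have h15 : x * (r * Real.cos ζ.im) ≤ 0 :=
      mul_nonpos_of_nonneg_of_nonpos hx.le (mul_nonpos_of_nonneg_of_nonpos hr1.le hcos)
    linarith

lemma G_diff {a b δ c t x : ℝ} (hb : 0 < b) (hδ : 0 < δ) (hc : 0 < c) (ht : 0 ≤ t) {ζ : ℂ}
    (hζ : ζ ∈ S δ) : DifferentiableAt ℂ (G a b δ c t x) ζ := by
  have := P_diff hb hδ hc ht hζ
  unfold G
  fun_prop

lemma ray_mem {δ θ u : ℝ} (hδ : 0 < δ) (hδ1 : δ < 1) (h1 : π / 2 ≤ θ) (h2 : θ ≤ π) :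
    (u : ℂ) + (θ : ℂ) * Complex.I ∈ S δ :=
  (strip_mem hδ hδ1 (ζ := (u : ℂ) + (θ : ℂ) * Complex.I) (by simpa using h1) (by simpa using h2)).2.2

lemma dom_int {C d δ : ℝ} (n : ℕ) (hδ1 : δ < 1) (hd : 0 < d) :
    IntegrableOn (fun r : ℝ => r ^ n * (C * Real.exp (-d * r ^ (1 - δ)))) (Set.Ioi 0) := by
  have h := (integrableOn_rpow_mul_exp_neg_mul_rpow (p := 1 - δ) (s := n) (b := d)
    (by have : (0:ℝ) ≤ n := n.cast_nonneg
        linarith) (by linarith) hd).const_mul C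
  refine h.congr ?_
  refine Filter.Eventually.of_forall fun r => ?_
  simp only [Real.rpow_natCast]
  ring

lemma ray_cont {a b δ c t x θ : ℝ} (hb : 0 < b) (hδ : 0 < δ) (hδ1 : δ < 1) (hc : 0 < c)
    (ht : 0 < t) (h1 : π / 2 ≤ θ) (h2 : θ ≤ π) :
    ContinuousOn (fun r : ℝ => G a b δ c t x ((Real.log r : ℂ) + (θ : ℂ) * Complex.I)) (Set.Ioi 0) := by
  intro r hr
  have hlog : ContinuousAt (fun r : ℝ => (Real.log r : ℂ) + (θ : ℂ) * Complex.I) r := by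
    have := Real.continuousAt_log (ne_of_gt hr)
    fun_prop
  exact (ContinuousAt.comp (f := fun r : ℝ => (Real.log r : ℂ) + (θ : ℂ) * Complex.I)
    (G_diff hb hδ hc ht.le (ray_mem hδ hδ1 h1 h2)).continuousAt hlog).continuousWithinAt

lemma ray_bound {a b δ c t x : ℝ} (ha : 0 < a) (hb : 0 < b) (hδ : 0 < δ) (hδ1 : δ < 1) (hc : 0 < c)
    (ht : 0 < t) (hx : 0 < x) :
    ∃ C > 0, ∃ d > 0, ∀ θ : ℝ, π / 2 ≤ θ → θ ≤ π → ∀ r : ℝ, 0 < r →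
      ‖G a b δ c t x ((Real.log r : ℂ) + (θ : ℂ) * Complex.I)‖ ≤ C * Real.exp (-d * r ^ (1 - δ)) := by
  obtain ⟨C, hC, d, hd, h⟩ := main_bound ha hb hδ hδ1 hc ht hx
  refine ⟨C, hC, d, hd, fun θ h1 h2 r hr => ?_⟩
  have := h ((Real.log r : ℂ) + (θ : ℂ) * Complex.I) (by simpa using h1) (by simpa using h2)
  simpa [Real.exp_log hr] using this

lemma ray_int {a b δ c t x θ : ℝ} (ha : 0 < a) (hb : 0 < b) (hδ : 0 < δ) (hδ1 : δ < 1) (hc : 0 < c)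
    (ht : 0 < t) (hx : 0 < x) (h1 : π / 2 ≤ θ) (h2 : θ ≤ π) :
    IntegrableOn (fun r : ℝ => G a b δ c t x ((Real.log r : ℂ) + (θ : ℂ) * Complex.I)) (Set.Ioi 0) := by
  obtain ⟨C, hC, d, hd, h⟩ := ray_bound ha hb hδ hδ1 hc ht hx
  refine (dom_int (C := C) (δ := δ) 0 hδ1 hd).mono'
    ((ray_cont hb hδ hδ1 hc ht h1 h2).aestronglyMeasurable measurableSet_Ioi) ?_
  refine (ae_restrict_iff' measurableSet_Ioi).2 (Filter.Eventually.of_forall fun r hr => ?_)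
  simpa using h θ h1 h2 r hr

lemma exp_image : Real.exp '' Set.univ = Set.Ioi 0 := by
  rw [Set.image_univ, Real.range_exp]

lemma ray_log {a b δ c t x θ : ℝ} (ha : 0 < a) (hb : 0 < b) (hδ : 0 < δ) (hδ1 : δ < 1) (hc : 0 < c)
    (ht : 0 < t) (hx : 0 < x) (h1 : π / 2 ≤ θ) (h2 : θ ≤ π) :
    Integrable (fun u : ℝ => Complex.exp ((u : ℂ) + (θ : ℂ) * Complex.I) *
        G a b δ c t x ((u : ℂ) + (θ : ℂ) * Complex.I)) ∧
    ∫ u : ℝ, Complex.exp ((u : ℂ) + (θ : ℂ) * Complex.I) * G a b δ c t x ((u : ℂ) + (θ : ℂ) * Complex.I) =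
      Complex.exp ((θ : ℂ) * Complex.I) *
        ∫ r in Set.Ioi (0:ℝ), G a b δ c t x ((Real.log r : ℂ) + (θ : ℂ) * Complex.I) := by
  have hd : ∀ x ∈ Set.univ, HasDerivWithinAt Real.exp (Real.exp x) Set.univ x :=
    fun x _ => (Real.hasDerivAt_exp x).hasDerivWithinAt
  have hcg : (fun u : ℝ => Complex.exp ((u : ℂ) + (θ : ℂ) * Complex.I) *
        G a b δ c t x ((u : ℂ) + (θ : ℂ) * Complex.I)) = fun u : ℝ => Complex.exp ((θ : ℂ) * Complex.I) *
        (|Real.exp u| • G a b δ c t x ((Real.log (Real.exp u) : ℂ) + (θ : ℂ) * Complex.I)) := by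
    funext u
    rw [Complex.exp_add, Real.log_exp, abs_of_pos (Real.exp_pos u), Complex.real_smul, Complex.ofReal_exp]
    ring
  have hI := ray_int ha hb hδ hδ1 hc ht hx h1 h2
  rw [hcg]
  constructor
  · rw [← exp_image, integrableOn_image_iff_integrableOn_abs_deriv_smul MeasurableSet.univ hd
      Real.exp_injective.injOn, integrableOn_univ] at hI
    exact hI.const_mul _
  · rw [integral_const_mul, ← exp_image, integral_image_eq_integral_abs_deriv_smul MeasurableSet.univ hd
      Real.exp_injective.injOn, setIntegral_univ]

open Filter Topology in
lemma bound_tendsto {C d δ : ℝ} (hC : 0 < C) (hδ1 : δ < 1) (hd : 0 < d) :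
    Tendsto (fun u : ℝ => Real.exp u * (C * Real.exp (-d * (Real.exp u) ^ (1 - δ)))) atTop (𝓝 0) ∧
    Tendsto (fun u : ℝ => Real.exp u * (C * Real.exp (-d * (Real.exp u) ^ (1 - δ)))) atBot (𝓝 0) := by
  have hp : 0 < 1 - δ := by linarith
  constructor
  · have h1 := tendsto_rpow_mul_exp_neg_mul_atTop_nhds_zero (1 / (1 - δ)) d hd
    have h2 : Tendsto (fun u : ℝ => (Real.exp u) ^ (1 - δ)) atTop atTop :=
      (tendsto_rpow_atTop hp).comp Real.tendsto_exp_atTop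
    have h3 := (h1.comp h2).const_mul C
    rw [mul_zero] at h3
    refine h3.congr fun u => ?_
    simp only [Function.comp]
    rw [← Real.rpow_mul (Real.exp_pos u).le, mul_one_div_cancel hp.ne', Real.rpow_one]
    ring
  · have h1 := Real.tendsto_exp_atBot.mul_const C
    rw [zero_mul] at h1
    refine squeeze_zero (fun u => by positivity) (fun u => ?_) h1
    have : Real.exp (-d * (Real.exp u) ^ (1 - δ)) ≤ 1 := by
      rw [Real.exp_le_one_iff]
      have : 0 < d * (Real.exp u) ^ (1 - δ) := by positivity
      linarith
    gcongr
    nlinarith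

open Filter Topology in
lemma contour {a b δ c t x : ℝ} (ha : 0 < a) (hb : 0 < b) (hδ : 0 < δ) (hδ1 : δ < 1) (hc : 0 < c)
    (ht : 0 < t) (hx : 0 < x) :
    ∫ r in Set.Ioi (0:ℝ), G a b δ c t x ((Real.log r : ℂ) + ((π / 2 : ℝ) : ℂ) * Complex.I) =
      Complex.I * ∫ r in Set.Ioi (0:ℝ), G a b δ c t x ((Real.log r : ℂ) + (π : ℂ) * Complex.I) := by
  have hp := Real.pi_pos
  have hp2 : π / 2 ≤ π := by linarith
  set h : ℂ → ℂ := fun ζ => Complex.exp ζ * G a b δ c t x ζ with hh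
  obtain ⟨i1, e1⟩ := ray_log ha hb hδ hδ1 hc ht hx le_rfl hp2
  obtain ⟨i2, e2⟩ := ray_log ha hb hδ hδ1 hc ht hx hp2 le_rfl
  obtain ⟨C, hC, d, hd, hbd⟩ := main_bound ha hb hδ hδ1 hc ht hx
  have hbd2 : ∀ u y : ℝ, π / 2 ≤ y → y ≤ π → ‖h ((u : ℂ) + (y : ℂ) * Complex.I)‖ ≤
      Real.exp u * (C * Real.exp (-d * (Real.exp u) ^ (1 - δ))) := by
    intro u y h1 h2
    have := hbd ((u : ℂ) + (y : ℂ) * Complex.I) (by simpa using h1) (by simpa using h2)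
    simp only [hh, norm_mul, Complex.norm_exp]
    simp only [Complex.add_re, Complex.ofReal_re, Complex.mul_re, Complex.I_re, mul_zero,
      Complex.ofReal_im, Complex.I_im, mul_one, sub_self, add_zero] at this ⊢
    gcongr
  have hbd3 : ∀ u : ℝ, ‖∫ y in (π / 2)..π, h ((u : ℂ) + (y : ℂ) * Complex.I)‖ ≤
      Real.exp u * (C * Real.exp (-d * (Real.exp u) ^ (1 - δ))) * |π - π / 2| := by
    intro u
    apply intervalIntegral.norm_integral_le_of_norm_le_const
    intro y hy
    rw [Set.uIoc_of_le hp2] at hy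
    exact hbd2 u y hy.1.le hy.2
  obtain ⟨bt1, bt2⟩ := bound_tendsto hC hδ1 hd
  have bt3 := bt1.mul_const (|π - π / 2|)
  have bt4 := bt2.mul_const (|π - π / 2|)
  rw [zero_mul] at bt3 bt4
  have v1 : Tendsto (fun u : ℝ => ∫ y in (π / 2)..π, h ((u : ℂ) + (y : ℂ) * Complex.I)) atTop (𝓝 0) :=
    squeeze_zero_norm hbd3 bt3
  have v2 : Tendsto (fun u : ℝ => ∫ y in (π / 2)..π, h ((u : ℂ) + (y : ℂ) * Complex.I)) atBot (𝓝 0) :=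
    squeeze_zero_norm hbd3 bt4
  have l1 := intervalIntegral_tendsto_integral i1 tendsto_neg_atTop_atBot tendsto_id
  have l2 := intervalIntegral_tendsto_integral i2 tendsto_neg_atTop_atBot tendsto_id
  have rect : ∀ R : ℝ, (∫ u in (-R)..R, h ((u : ℂ) + ((π / 2 : ℝ) : ℂ) * Complex.I)) -
      (∫ u in (-R)..R, h ((u : ℂ) + (π : ℂ) * Complex.I)) +
      Complex.I * (∫ y in (π / 2)..π, h ((R : ℂ) + (y : ℂ) * Complex.I)) -
      Complex.I * (∫ y in (π / 2)..π, h (((-R : ℝ) : ℂ) + (y : ℂ) * Complex.I)) = 0 := by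
    intro R
    have := Complex.integral_boundary_rect_eq_zero_of_differentiableOn h ⟨-R, π / 2⟩ ⟨R, π⟩ ?_
    · simpa only [smul_eq_mul] using this
    · intro ζ hζ
      have hζ2 := hζ.2
      simp only [Set.mem_preimage, Set.uIcc_of_le hp2, Set.mem_Icc] at hζ2
      have := G_diff (a := a) (x := x) hb hδ hc ht.le (strip_mem hδ hδ1 hζ2.1 hζ2.2).2.2
      apply DifferentiableAt.differentiableWithinAt
      simp only [hh]
      fun_prop
  have lim := ((l1.sub l2).add (v1.const_mul Complex.I)).sub
    ((v2.comp tendsto_neg_atTop_atBot).const_mul Complex.I)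
  have lim0 := tendsto_nhds_unique (lim.congr (f₂ := fun _ => 0) (fun R => rect R)) tendsto_const_nhds
  rw [mul_zero, add_zero, sub_zero, e1, e2, Complex.exp_pi_mul_I] at lim0
  have hi : Complex.exp (((π / 2 : ℝ) : ℂ) * Complex.I) = Complex.I := by
    push_cast; exact Complex.exp_pi_div_two_mul_I
  rw [hi] at lim0
  linear_combination (-Complex.I) * lim0 +
    (∫ r in Set.Ioi (0:ℝ), G a b δ c t x ((Real.log r : ℂ) + ((π / 2 : ℝ) : ℂ) * Complex.I)) * Complex.I_sq

lemma vC_base (b α s : ℝ) {ζ : ℂ} (h1 : -π < ζ.im) (h2 : ζ.im ≤ π) :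
    ((1 / ((α : ℂ) * (b : ℂ)) + (Complex.exp ζ) ^ ((1 : ℂ) - (α : ℂ))) *
      Complex.exp ((b * (α - 1) * s : ℝ) : ℂ) - 1 / ((α : ℂ) * (b : ℂ))) =
    W b (α - 1) (1 / (α * b)) s ζ := by
  rw [Complex.cpow_def_of_ne_zero (Complex.exp_ne_zero _), Complex.log_exp h1 h2, W]
  have : -((α - 1 : ℝ) : ℂ) * ζ = ζ * (1 - (α : ℂ)) := by push_cast; ring
  rw [this]
  push_cast
  ring

lemma vC_eq (b α s : ℝ) {ζ : ℂ} (h1 : -π < ζ.im) (h2 : ζ.im ≤ π) :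
    vC b α s (Complex.exp ζ) = V b (α - 1) (1 / (α * b)) s ζ := by
  rw [vC, vC_base b α s h1 h2, V]
  congr 1
  push_cast
  rw [← neg_sub (1 : ℂ) (α : ℂ), one_div, one_div, inv_neg, neg_neg]

lemma neg_eq {z : ℝ} (hz : 0 < z) : -(z : ℂ) = Complex.exp ((Real.log z : ℂ) + (π : ℂ) * Complex.I) := by
  rw [Complex.exp_add, Complex.exp_pi_mul_I, ← Complex.ofReal_exp, Real.exp_log hz]; ring

lemma I_eq {z : ℝ} (hz : 0 < z) : Complex.I * (z : ℂ) =
    Complex.exp ((Real.log z : ℂ) + ((π / 2 : ℝ) : ℂ) * Complex.I) := by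
  have hi : Complex.exp (((π / 2 : ℝ) : ℂ) * Complex.I) = Complex.I := by
    push_cast; exact Complex.exp_pi_div_two_mul_I
  rw [Complex.exp_add, hi, ← Complex.ofReal_exp, Real.exp_log hz]; ring

lemma G_neg (a b α t x : ℝ) {z : ℝ} (hz : 0 < z) :
    G a b (α - 1) (1 / (α * b)) t x ((Real.log z : ℂ) + (π : ℂ) * Complex.I) =
    Complex.exp (-(x : ℂ) * (z : ℂ)) * Complex.exp (-(a : ℂ) * ∫ s in (0:ℝ)..t, vC b α s (-(z : ℂ))) := by
  have hp := Real.pi_pos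
  rw [G, P, neg_eq hz]
  simp_rw [fun s => vC_eq b α s (ζ := (Real.log z : ℂ) + (π : ℂ) * Complex.I)
    (by simp; linarith) (by simp)]
  rw [← neg_eq hz]
  ring_nf

lemma G_I (a b α t x : ℝ) {z : ℝ} (hz : 0 < z) :
    G a b (α - 1) (1 / (α * b)) t x ((Real.log z : ℂ) + ((π / 2 : ℝ) : ℂ) * Complex.I) =
    Complex.exp (Complex.I * (x : ℂ) * (z : ℂ)) *
      Complex.exp (-(a : ℂ) * ∫ s in (0:ℝ)..t, vC b α s (Complex.I * (z : ℂ))) := by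
  have hp := Real.pi_pos
  rw [G, P, I_eq hz]
  simp_rw [fun s => vC_eq b α s (ζ := (Real.log z : ℂ) + ((π / 2 : ℝ) : ℂ) * Complex.I)
    (by simp; linarith) (by simp; linarith)]
  rw [← I_eq hz]
  ring_nf

open ComplexConjugate in
lemma vC_conj {b α s z : ℝ} (hb : 0 < b) (hα : 1 < α) (hα2 : α < 2) (hs : 0 ≤ s) (hz : 0 < z) :
    vC b α s (-Complex.I * (z : ℂ)) = conj (vC b α s (Complex.I * (z : ℂ))) := by
  have hp := Real.pi_pos
  have h0 : -Complex.I * (z : ℂ) = conj (Complex.I * (z : ℂ)) := by simp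
  have harg : (Complex.I * (z : ℂ)).arg ≠ π := by
    intro h
    rw [Complex.arg_eq_pi_iff] at h
    simp at h
  have h1 : (conj (Complex.I * (z : ℂ))) ^ ((1 : ℂ) - (α : ℂ)) =
      conj ((Complex.I * (z : ℂ)) ^ ((1 : ℂ) - (α : ℂ))) := by
    rw [Complex.conj_cpow _ _ harg]; simp
  have hW : ((1 / ((α : ℂ) * (b : ℂ)) + (Complex.I * (z : ℂ)) ^ ((1 : ℂ) - (α : ℂ))) *
      Complex.exp ((b * (α - 1) * s : ℝ) : ℂ) - 1 / ((α : ℂ) * (b : ℂ))) ∈ Complex.slitPlane := by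
    rw [I_eq hz, vC_base b α s (by simp; linarith) (by simp; linarith)]
    exact W_slit hb (by linarith) (by positivity) hs
      (ray_mem (θ := π / 2) (by linarith) (by linarith) le_rfl (by linarith))
  rw [h0, vC, vC, h1]
  have h2 := Complex.conj_cpow _ ((1 : ℂ) / (1 - (α : ℂ))) (Complex.slitPlane_arg_ne_pi hW)
  have h3 : conj ((1 : ℂ) / (1 - (α : ℂ))) = (1 : ℂ) / (1 - (α : ℂ)) := by simp
  rw [h3] at h2
  rw [← h2]
  congr 1
  simp [← Complex.exp_conj]

end Q13

theorem stmt_13 (a b α t : ℝ) (ha : 0 < a) (hb : 0 < b) (hα : 1 < α) (hα2 : α < 2)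
    (ht : 0 < t) :
    (∀ w : ℂ, 0 < w.re →
      IntegrableOn (fun z : ℝ => Complex.exp (-w * (z : ℂ)) *
          (((-(Complex.exp (-(a : ℂ) * ∫ s in (0:ℝ)..t, vC b α s (-(z : ℂ)))).im : ℝ)) : ℂ))
        (Set.Ioi (0:ℝ))) ∧
    DifferentiableOn ℂ (Fext a b α t) {w : ℂ | 0 < w.re} ∧
    (∀ x : ℝ, 0 < x → Fext a b α t ((x : ℝ) : ℂ) = fDen a b α t x) := by
  have hp := Real.pi_pos
  have hδ : 0 < α - 1 := by linarith
  have hδ1 : α - 1 < 1 := by linarith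
  have hc : 0 < 1 / (α * b) := by positivity
  have hp2 : π / 2 ≤ π := by linarith
  set Φ : ℝ → ℂ := fun z => Complex.exp (-(a : ℂ) * ∫ s in (0:ℝ)..t, vC b α s (-(z : ℂ))) with hΦ
  have hcont : ContinuousOn Φ (Set.Ioi 0) := by
    refine (Q13.ray_cont (a := a) (x := 0) hb hδ hδ1 hc ht hp2 le_rfl).congr fun z hz => ?_
    beta_reduce
    rw [Q13.G_neg a b α t 0 hz]
    simp [hΦ]
  have hnorm : ∀ (w : ℂ) (x : ℝ), x ≤ w.re → ∀ z : ℝ, 0 < z →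
      ‖Complex.exp (-w * (z : ℂ)) * (((-(Φ z).im : ℝ)) : ℂ)‖ ≤
      ‖Q13.G a b (α - 1) (1 / (α * b)) t x ((Real.log z : ℂ) + (π : ℂ) * Complex.I)‖ := by
    intro w x hxw z hz
    rw [Q13.G_neg a b α t x hz, norm_mul, norm_mul, Complex.norm_exp, Complex.norm_exp]
    refine mul_le_mul (Real.exp_le_exp.2 ?_) ?_ (norm_nonneg _) (Real.exp_pos _).le
    · simp only [neg_mul, Complex.neg_re, Complex.re_mul_ofReal, Complex.ofReal_re]
      exact neg_le_neg (mul_le_mul_of_nonneg_right hxw hz.le)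
    · rw [Complex.norm_real, norm_neg]
      exact Complex.abs_im_le_norm (Φ z)
  have hmeas : ∀ w : ℂ, AEStronglyMeasurable
      (fun z : ℝ => Complex.exp (-w * (z : ℂ)) * (((-(Φ z).im : ℝ)) : ℂ))
      (volume.restrict (Set.Ioi 0)) := by
    intro w
    refine ContinuousOn.aestronglyMeasurable ?_ measurableSet_Ioi
    have : ContinuousOn (fun z => (((-(Φ z).im : ℝ)) : ℂ)) (Set.Ioi 0) :=
      Complex.continuous_ofReal.comp_continuousOn (Complex.continuous_im.comp_continuousOn hcont).neg
    exact ContinuousOn.mul (by fun_prop) this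
  have hint : ∀ w : ℂ, 0 < w.re → IntegrableOn
      (fun z : ℝ => Complex.exp (-w * (z : ℂ)) * (((-(Φ z).im : ℝ)) : ℂ)) (Set.Ioi 0) := by
    intro w hw
    refine (Q13.ray_int ha hb hδ hδ1 hc ht hw hp2 le_rfl).norm.mono' (hmeas w) ?_
    exact (ae_restrict_iff' measurableSet_Ioi).2 (Filter.Eventually.of_forall fun z hz =>
      hnorm w w.re le_rfl z hz)
  refine ⟨hint, ?_, ?_⟩
  · intro w hw
    have hw' : 0 < w.re := hw
    apply DifferentiableAt.differentiableWithinAt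
    obtain ⟨C, hC, d, hd, hbd⟩ := Q13.ray_bound ha hb hδ hδ1 hc ht (half_pos hw')
    have hs : {v : ℂ | w.re / 2 < v.re} ∈ nhds w :=
      (isOpen_lt continuous_const Complex.continuous_re).mem_nhds (by
        change w.re / 2 < w.re
        linarith)
    have key := (hasDerivAt_integral_of_dominated_loc_of_deriv_le
      (μ := volume.restrict (Set.Ioi (0:ℝ))) (x₀ := w) hs
      (F := fun w z => Complex.exp (-w * (z : ℂ)) * (((-(Φ z).im : ℝ)) : ℂ))
      (F' := fun w z => (-(z : ℂ)) * (Complex.exp (-w * (z : ℂ)) * (((-(Φ z).im : ℝ)) : ℂ)))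
      (bound := fun r => r ^ 1 * (C * Real.exp (-d * r ^ (1 - (α - 1)))))
      (Filter.Eventually.of_forall fun v => hmeas v) (hint w hw') ?_ ?_
      (Q13.dom_int 1 hδ1 hd) ?_).2
    · exact (key.differentiableAt.const_mul _)
    · exact AEStronglyMeasurable.mul (Continuous.aestronglyMeasurable (by fun_prop)) (hmeas w)
    · refine (ae_restrict_iff' measurableSet_Ioi).2 (Filter.Eventually.of_forall fun z hz v hv => ?_)
      have hz0 : 0 < z := hz
      rw [norm_mul, norm_neg, Complex.norm_real, Real.norm_eq_abs, abs_of_pos hz0, pow_one]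
      gcongr
      exact (hnorm v (w.re / 2) (le_of_lt hv) z hz0).trans (hbd π hp2 le_rfl z hz0)
    · refine Filter.Eventually.of_forall fun z v _ => ?_
      have h1 : HasDerivAt (fun v : ℂ => -v * (z : ℂ)) (-1 * (z : ℂ)) v :=
        (hasDerivAt_id v).neg.mul_const _
      refine (h1.cexp.mul_const (((-(Φ z).im : ℝ)) : ℂ)).congr_deriv ?_
      ring
  · intro x hx
    set K := ∫ r in Set.Ioi (0:ℝ),
      Q13.G a b (α - 1) (1 / (α * b)) t x ((Real.log r : ℂ) + (π : ℂ) * Complex.I) with hK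
    have hJ := Q13.contour ha hb hδ hδ1 hc ht hx
    rw [← hK] at hJ
    have hF : (∫ z in Set.Ioi (0:ℝ), Complex.exp (-(x : ℂ) * (z : ℂ)) * (((-(Φ z).im : ℝ)) : ℂ)) =
        ((-K.im : ℝ) : ℂ) := by
      have h1 : K.im = ∫ r in Set.Ioi (0:ℝ),
          (Q13.G a b (α - 1) (1 / (α * b)) t x ((Real.log r : ℂ) + (π : ℂ) * Complex.I)).im := by
        have := integral_im (𝕜 := ℂ) (Q13.ray_int ha hb hδ hδ1 hc ht hx hp2 le_rfl)
        exact this.symm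
      rw [h1, ← integral_neg]
      refine Eq.trans ?_ integral_ofReal
      refine setIntegral_congr_fun measurableSet_Ioi fun z hz => ?_
      have hz0 : 0 < z := hz
      beta_reduce
      rw [Q13.G_neg a b α t x hz0]
      have h2 : Complex.exp (-(x : ℂ) * (z : ℂ)) = ((Real.exp (-x * z) : ℝ) : ℂ) := by push_cast; rfl
      rw [h2, Complex.im_ofReal_mul, ← Complex.ofReal_mul]
      change ((Real.exp (-x * z) * -(Φ z).im : ℝ) : ℂ) = ((-(Real.exp (-x * z) * (Φ z).im) : ℝ) : ℂ)
      congr 1; ring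
    set g : ℝ → ℂ := fun ξ => Complex.exp (-Complex.I * (x : ℂ) * (ξ : ℂ)) *
      Complex.exp (-(a : ℂ) * ∫ s in (0:ℝ)..t, vC b α s (-Complex.I * (ξ : ℂ))) with hg
    have hg1 : ∀ z : ℝ, 0 < z → g (-z) =
        Q13.G a b (α - 1) (1 / (α * b)) t x ((Real.log z : ℂ) + ((π / 2 : ℝ) : ℂ) * Complex.I) := by
      intro z hz
      rw [Q13.G_I a b α t x hz]
      simp only [hg, Complex.ofReal_neg, neg_mul, mul_neg, neg_neg]
    have hg2 : ∀ z : ℝ, 0 < z → g z = (starRingEnd ℂ) (g (-z)) := by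
      intro z hz
      have h3 : (∫ s in (0:ℝ)..t, vC b α s (-Complex.I * (z : ℂ))) =
          (starRingEnd ℂ) (∫ s in (0:ℝ)..t, vC b α s (Complex.I * (z : ℂ))) := by
        rw [← intervalIntegral.intervalIntegral_conj]
        refine intervalIntegral.integral_congr fun s hs => ?_
        rw [Set.uIcc_of_le ht.le] at hs
        exact Q13.vC_conj hb hα hα2 hs.1 hz
      rw [hg1 z hz, Q13.G_I a b α t x hz]
      simp only [hg]
      rw [h3, map_mul, ← Complex.exp_conj, ← Complex.exp_conj]
      simp
    have hiI : IntegrableOn (fun z => g (-z)) (Set.Ioi 0) :=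
      (Q13.ray_int ha hb hδ hδ1 hc ht hx le_rfl hp2).congr_fun (fun z hz => (hg1 z hz).symm)
        measurableSet_Ioi
    have hJ2 : ∫ z in Set.Ioi (0:ℝ), g (-z) = Complex.I * K := by
      rw [← hJ]
      exact setIntegral_congr_fun measurableSet_Ioi fun z hz => hg1 z hz
    have hi1 : IntegrableOn g (Set.Ioi 0) := by
      refine IntegrableOn.congr_fun (f := fun z => (starRingEnd ℂ) (g (-z))) ?_
        (fun z hz => (hg2 z hz).symm) measurableSet_Ioi
      exact (Complex.conjLIE.toContinuousLinearEquiv.toContinuousLinearMap).integrable_comp hiI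
    have hi2 : IntegrableOn g (Set.Iic 0) := by
      rw [integrableOn_Iic_iff_integrableOn_Iio]
      have h7 := (Measure.measurePreserving_neg (volume : Measure ℝ)).integrableOn_comp_preimage
        (Homeomorph.neg ℝ).measurableEmbedding (f := g) (s := Set.Iio 0)
      refine h7.1 ?_
      have h8 : (Neg.neg ⁻¹' (Set.Iio (0:ℝ))) = Set.Ioi 0 := by ext y; simp
      rw [h8]
      exact hiI
    have hsum : ∫ ξ, g ξ = (starRingEnd ℂ) (Complex.I * K) + Complex.I * K := by
      rw [← intervalIntegral.integral_Iic_add_Ioi hi2 hi1]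
      have h4 : ∫ z in Set.Iic (0:ℝ), g z = Complex.I * K := by
        rw [← hJ2, integral_comp_neg_Ioi, neg_zero]
      have h5 : ∫ z in Set.Ioi (0:ℝ), g z = (starRingEnd ℂ) (Complex.I * K) := by
        rw [← hJ2, ← integral_conj]
        exact setIntegral_congr_fun measurableSet_Ioi fun z hz => hg2 z hz
      rw [h4, h5, add_comm]
    rw [Fext, fDen]
    change ((1 / Real.pi : ℝ) : ℂ) * (∫ z in Set.Ioi (0:ℝ), Complex.exp (-(x : ℂ) * (z : ℂ)) *
      (((-(Φ z).im : ℝ)) : ℂ)) = ((1 / (2 * Real.pi) : ℝ) : ℂ) * ∫ ξ, g ξ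
    rw [hF, hsum]
    have h6 : (starRingEnd ℂ) (Complex.I * K) + Complex.I * K = ((-2 * K.im : ℝ) : ℂ) := by
      apply Complex.ext <;> simp
      ring
    rw [h6, ← Complex.ofReal_mul, ← Complex.ofReal_mul]
    congr 1
    field_simp
end
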